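/- arXiv:2409.03128 — 6 statements merged into one kernel-verified Lean document; each statement's English description precedes it below -/
import Mathlib

section
/- For every ε > 0 there exist constants δ > 0 and c > 0 such that for every prime p and every set A ⊆ 𝔽_p with |A| ≤ p^{1−ε}, A contains a bi-Sidon subset S ⊆ A with |S| ≥ c · |A|^{1/3 + δ}. -/
/-- A set is additive Sidon if all pairwise sums are distinct. -/
def IsAddSidon {α : Type*} [Add α] (S : Set α) : Prop :=
  ∀ a ∈ S, ∀ b ∈ S, ∀ a' ∈ S, ∀ b' ∈ S, a + b = a' + b' → ({a, b} : Set α) = {a', b'}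

/-- A set is multiplicative Sidon if all pairwise products are distinct. -/
def IsMulSidon {α : Type*} [Mul α] (S : Set α) : Prop :=
  ∀ a ∈ S, ∀ b ∈ S, ∀ a' ∈ S, ∀ b' ∈ S, a * b = a' * b' → ({a, b} : Set α) = {a', b'}

/-- A set is bi-Sidon if it is both additive and multiplicative Sidon. -/
def IsBiSidon {α : Type*} [Add α] [Mul α] (S : Set α) : Prop :=
  IsAddSidon S ∧ IsMulSidon S

set_option exponentiation.threshold 1000

section Helpers

open Finset
open scoped Pointwise

theorem div_add_div_eq_of_add_eq {w a b c d : ℕ} (hw : 0 < w) (h : a + b = c + d)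
    (hac : 2 * (a % w) < w ↔ 2 * (c % w) < w) (had : 2 * (a % w) < w ↔ 2 * (d % w) < w)
    (hab : 2 * (a % w) < w ↔ 2 * (b % w) < w) :
    a / w + b / w = c / w + d / w ∧ a % w + b % w = c % w + d % w := by
  have ha := Nat.div_add_mod a w
  have hb := Nat.div_add_mod b w
  have hc := Nat.div_add_mod c w
  have hd := Nat.div_add_mod d w
  have la := Nat.mod_lt a hw
  have lb := Nat.mod_lt b hw
  have lc := Nat.mod_lt c hw
  have ld := Nat.mod_lt d hw
  generalize a / w = a1 at *
  generalize b / w = b1 at *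
  generalize c / w = c1 at *
  generalize d / w = d1 at *
  generalize a % w = a2 at *
  generalize b % w = b2 at *
  generalize c % w = c2 at *
  generalize d % w = d2 at *
  have key : w * (a1 + b1) + (a2 + b2) = w * (c1 + d1) + (c2 + d2) := by
    rw [mul_add, mul_add]; omega
  have hq : a1 + b1 = c1 + d1 := by
    rcases lt_trichotomy (a1 + b1) (c1 + d1) with hlt | heq | hlt
    · have : w * (a1 + b1 + 1) ≤ w * (c1 + d1) := Nat.mul_le_mul_left w hlt
      rw [mul_add] at this
      by_cases h2 : 2 * a2 < w
      · have := hac.1 h2; have := had.1 h2; have := hab.1 h2; omega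
      · have := mt hac.2 h2; have := mt had.2 h2; have := mt hab.2 h2; omega
    · exact heq
    · have : w * (c1 + d1 + 1) ≤ w * (a1 + b1) := Nat.mul_le_mul_left w hlt
      rw [mul_add] at this
      by_cases h2 : 2 * a2 < w
      · have := hac.1 h2; have := had.1 h2; have := hab.1 h2; omega
      · have := mt hac.2 h2; have := mt had.2 h2; have := mt hab.2 h2; omega
  refine ⟨hq, ?_⟩
  rw [hq] at key
  omega

theorem val_add_val_eq_of_add_eq {q : ℕ} [NeZero q] {a b c d : ZMod q} (h : a + b = c + d)
    (hac : 2 * a.val < q ↔ 2 * c.val < q) (had : 2 * a.val < q ↔ 2 * d.val < q)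
    (hab : 2 * a.val < q ↔ 2 * b.val < q) :
    a.val + b.val = c.val + d.val := by
  have h1 : (a.val + b.val) % q = (c.val + d.val) % q := by
    rw [← ZMod.val_add, ← ZMod.val_add, h]
  have la := ZMod.val_lt a
  have lb := ZMod.val_lt b
  have lc := ZMod.val_lt c
  have ld := ZMod.val_lt d
  by_cases h2 : 2 * a.val < q
  · have := hac.1 h2
    have := had.1 h2
    have := hab.1 h2
    rwa [Nat.mod_eq_of_lt (by omega), Nat.mod_eq_of_lt (by omega)] at h1
  · have := mt hac.2 h2
    have := mt had.2 h2
    have := mt hab.2 h2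
    rw [Nat.mod_eq_sub_mod (by omega), Nat.mod_eq_sub_mod (a := c.val + d.val) (by omega),
      Nat.mod_eq_of_lt (by omega), Nat.mod_eq_of_lt (by omega)] at h1
    omega

/-- A nonzero residue `h` has few multiples `l * h` making two residues at distance `h` fall into
the same block of length `w`. -/
theorem card_dilates_same_block_le {q : ℕ} [Fact q.Prime] {x y : ZMod q} (hxy : x ≠ y) (w : ℕ)
    (hw : 0 < w) :
    #{l ∈ (univ : Finset (ZMod q)).erase 0 | (l * x).val / w = (l * y).val / w}
      ≤ 2 * (w - 1) := by
  classical
  let D : Finset (ZMod q) := (Icc 1 (w - 1)).image (fun s : ℕ => (s : ZMod q)) ∪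
    (Icc 1 (w - 1)).image (fun s : ℕ => -(s : ZMod q))
  have hD : #D ≤ 2 * (w - 1) := by
    refine (card_union_le _ _).trans ?_
    have h1 := card_image_le (s := Icc 1 (w - 1)) (f := fun s : ℕ => (s : ZMod q))
    have h2 := card_image_le (s := Icc 1 (w - 1)) (f := fun s : ℕ => -(s : ZMod q))
    simp only [Nat.card_Icc] at h1 h2
    omega
  refine le_trans (card_le_card_of_injOn (t := D) (fun l => l * (x - y)) ?_ ?_) hD
  · intro l hl
    simp only [coe_filter, mem_erase, mem_univ, and_true, Set.mem_ofPred_eq] at hl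
    obtain ⟨hl0, hl⟩ := hl
    have hne : (l * x).val ≠ (l * y).val := fun h =>
      hxy (mul_left_cancel₀ hl0 (ZMod.val_injective q h))
    have h1 := Nat.div_add_mod (l * x).val w
    have h2 := Nat.div_add_mod (l * y).val w
    have l1 := Nat.mod_lt (l * x).val hw
    have l2 := Nat.mod_lt (l * y).val hw
    rw [hl] at h1
    have e1 : l * (x - y) = ((l * x).val : ZMod q) - ((l * y).val : ZMod q) := by
      rw [ZMod.natCast_zmod_val, ZMod.natCast_zmod_val]; ring
    simp only [D, coe_union, coe_image, Set.mem_union, Set.mem_image, coe_Icc, Set.mem_Icc]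
    rcases lt_or_gt_of_ne hne with h | h
    · right
      refine ⟨(l * y).val - (l * x).val, by omega, ?_⟩
      rw [e1, Nat.cast_sub h.le]; ring
    · left
      refine ⟨(l * x).val - (l * y).val, by omega, ?_⟩
      rw [e1, Nat.cast_sub h.le]
  · intro l _ l' _ h
    exact mul_right_cancel₀ (sub_ne_zero.2 hxy) h

/-- A set of residues has a large subset that is Freiman-isomorphic to a set of pairs of digits in
base `r`. -/
theorem exists_digit_map {α : Type*} {q : ℕ} [Fact q.Prime] (B : Finset α)
    (f : α → ZMod q) (hf : Set.InjOn f B) (r : ℕ) (hr0 : 0 < r) (hr : 64 * #B ≤ r ^ 2) :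
    ∃ B₀ ⊆ B, #B ≤ 16 * #B₀ ∧ ∃ φ ψ : α → ℕ, (∀ a ∈ B₀, φ a < r ∧ ψ a < r) ∧
      (∀ a ∈ B₀, ∀ b ∈ B₀, φ a = φ b → ψ a = ψ b → a = b) ∧
      (∀ a ∈ B₀, ∀ b ∈ B₀, ∀ c ∈ B₀, ∀ d ∈ B₀, f a + f b = f c + f d →
        φ a + φ b = φ c + φ d ∧ ψ a + ψ b = ψ c + ψ d) := by
  classical
  have hq2 : 2 ≤ q := (Fact.out : q.Prime).two_le
  set w := q / r ^ 2 + 1 with hw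
  have hw0 : 0 < w := Nat.succ_pos _
  have hqw : q < w * r ^ 2 := by
    have := Nat.lt_div_mul_add (a := q) (b := r ^ 2) (by positivity)
    rw [hw, add_mul, one_mul]; exact this
  let coll : ZMod q → Finset (α × α) := fun l =>
    {x ∈ B.offDiag | (l * f x.1).val / w = (l * f x.2).val / w}
  obtain ⟨l, hl0, hl⟩ : ∃ l : ZMod q, l ≠ 0 ∧ 16 * #(coll l) ≤ #B := by
    have hsum : ∑ l ∈ (univ : Finset (ZMod q)).erase 0, #(coll l)
        ≤ ∑ x ∈ B.offDiag, 2 * (w - 1) := by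
      have : ∑ l ∈ (univ : Finset (ZMod q)).erase 0, #(coll l) = ∑ x ∈ B.offDiag,
          #{l ∈ (univ : Finset (ZMod q)).erase 0 |
            (l * f x.1).val / w = (l * f x.2).val / w} :=
        sum_card_bipartiteAbove_eq_sum_card_bipartiteBelow _
      rw [this]
      refine sum_le_sum fun x hx => ?_
      rw [mem_offDiag] at hx
      exact card_dilates_same_block_le (fun h => hx.2.2 (hf hx.1 hx.2.1 h)) w hw0
    by_contra! hcon
    have hlow : ∑ l ∈ (univ : Finset (ZMod q)).erase 0, 16 * #(coll l)
        ≥ ∑ l ∈ (univ : Finset (ZMod q)).erase 0, (#B + 1) :=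
      sum_le_sum fun l hl => hcon l (ne_of_mem_erase hl)
    rw [← mul_sum, sum_const, card_erase_of_mem (mem_univ _), card_univ, ZMod.card,
      smul_eq_mul] at hlow
    rw [sum_const, offDiag_card, smul_eq_mul] at hsum
    have h1 : (q - 1) * (#B + 1) ≤ 16 * ((#B * #B) * (2 * (w - 1))) :=
      hlow.trans (Nat.mul_le_mul_left _ (hsum.trans (Nat.mul_le_mul_right _ (Nat.sub_le _ _))))
    have h2 : (w - 1) * r ^ 2 ≤ q := by
      rw [hw, Nat.add_sub_cancel]; exact Nat.div_mul_le_self _ _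
    have h3 : q ≤ 2 * (q - 1) := by omega
    have h4 : (w - 1) * (64 * #B) ≤ 2 * (q - 1) :=
      (Nat.mul_le_mul_left _ hr).trans (h2.trans h3)
    have h5 : 32 * #B * ((w - 1) * #B) ≤ #B * (q - 1) := by nlinarith
    have h6 : 0 < q - 1 := by omega
    nlinarith
  let v : α → ℕ := fun a => (l * f a).val
  let cls : α → Prop × Prop × Prop := fun a =>
    (2 * v a < q, 2 * (v a % w) < w, 2 * (v a / w % r) < r)
  obtain ⟨k, -, hk⟩ : ∃ k ∈ (univ : Finset (Prop × Prop × Prop)), #B ≤ 8 * #{a ∈ B | cls a = k} := by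
    by_contra! hcon
    have := card_eq_sum_card_fiberwise (f := cls) (s := B) (t := univ) (fun _ _ => by simp)
    have h2 : ∑ k : Prop × Prop × Prop, 8 * #{a ∈ B | cls a = k}
        < ∑ k : Prop × Prop × Prop, #B :=
      sum_lt_sum_of_nonempty univ_nonempty fun k hk => hcon k hk
    rw [← mul_sum, ← this, sum_const, card_univ] at h2
    simp at h2
  set C := {a ∈ B | cls a = k} with hC
  set B₀ := {a ∈ C | ∀ c ∈ B, v c / w = v a / w → c = a} with hB₀
  have hsub : B₀ ⊆ C := filter_subset _ _
  have hCB : C ⊆ B := filter_subset _ _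
  refine ⟨B₀, hsub.trans hCB, ?_, fun a => v a / w % r, fun a => v a / w / r, ?_, ?_, ?_⟩
  · have hle : #(C \ B₀) ≤ #(coll l) := by
      refine le_trans (card_le_card (t := (coll l).image Prod.fst) ?_) card_image_le
      intro a ha
      rw [mem_sdiff] at ha
      have : ¬ ∀ c ∈ B, v c / w = v a / w → c = a := fun h => ha.2 (mem_filter.2 ⟨ha.1, h⟩)
      push Not at this
      obtain ⟨c, hc, h1, h2⟩ := this
      exact mem_image.2 ⟨(a, c), mem_filter.2 ⟨mem_offDiag.2 ⟨hCB ha.1, hc, h2.symm⟩, h1.symm⟩, rfl⟩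
    have := card_sdiff_add_card_eq_card hsub
    omega
  · intro a _
    refine ⟨Nat.mod_lt _ hr0, ?_⟩
    rw [Nat.div_lt_iff_lt_mul hr0, Nat.div_lt_iff_lt_mul hw0]
    calc v a < q := ZMod.val_lt _
      _ < _ := hqw
      _ = _ := by ring
  · intro a ha b hb h1 h2
    refine (mem_filter.1 hb).2 a (hCB (hsub ha)) ?_
    rw [← Nat.div_add_mod (v a / w) r, ← Nat.div_add_mod (v b / w) r]
    exact congrArg₂ (· + ·) (congrArg _ h2) h1
  · intro a ha b hb c hc d hd h
    have cl : ∀ x ∈ B₀, cls x = k := fun x hx => (mem_filter.1 (hsub hx)).2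
    have key : ∀ x ∈ B₀, ∀ y ∈ B₀, (2 * v x < q ↔ 2 * v y < q) ∧
        (2 * (v x % w) < w ↔ 2 * (v y % w) < w) ∧
        (2 * (v x / w % r) < r ↔ 2 * (v y / w % r) < r) := by
      intro x hx y hy
      have := (cl x hx).trans (cl y hy).symm
      simpa [cls, Prod.ext_iff] using this
    have e1 : v a + v b = v c + v d :=
      val_add_val_eq_of_add_eq (by rw [← mul_add, ← mul_add, h])
        (key a ha c hc).1 (key a ha d hd).1 (key a ha b hb).1
    have e2 := (div_add_div_eq_of_add_eq hw0 e1
        (key a ha c hc).2.1 (key a ha d hd).2.1 (key a ha b hb).2.1).1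
    exact (div_add_div_eq_of_add_eq hr0 e2
        (key a ha c hc).2.2 (key a ha d hd).2.2 (key a ha b hb).2.2).symm

theorem cubic_coeffs_eq_zero {F : Type*} [Field F] {x y z w c₀ c₁ c₂ c₃ : F}
    (hxy : x ≠ y) (hxz : x ≠ z) (hxw : x ≠ w) (hyz : y ≠ z) (hyw : y ≠ w) (hzw : z ≠ w)
    (hx : c₀ + c₁ * x + c₂ * x ^ 2 + c₃ * x ^ 3 = 0)
    (hy : c₀ + c₁ * y + c₂ * y ^ 2 + c₃ * y ^ 3 = 0)
    (hz : c₀ + c₁ * z + c₂ * z ^ 2 + c₃ * z ^ 3 = 0)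
    (hw : c₀ + c₁ * w + c₂ * w ^ 2 + c₃ * w ^ 3 = 0) :
    c₀ = 0 ∧ c₁ = 0 ∧ c₂ = 0 ∧ c₃ = 0 := by
  have e1 : c₁ + c₂ * (x + y) + c₃ * (x ^ 2 + x * y + y ^ 2) = 0 :=
    mul_left_cancel₀ (sub_ne_zero.2 hxy) (by linear_combination hx - hy)
  have e2 : c₁ + c₂ * (x + z) + c₃ * (x ^ 2 + x * z + z ^ 2) = 0 :=
    mul_left_cancel₀ (sub_ne_zero.2 hxz) (by linear_combination hx - hz)
  have e3 : c₁ + c₂ * (x + w) + c₃ * (x ^ 2 + x * w + w ^ 2) = 0 :=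
    mul_left_cancel₀ (sub_ne_zero.2 hxw) (by linear_combination hx - hw)
  have f1 : c₂ + c₃ * (x + y + z) = 0 :=
    mul_left_cancel₀ (sub_ne_zero.2 hyz) (by linear_combination e1 - e2)
  have f2 : c₂ + c₃ * (x + y + w) = 0 :=
    mul_left_cancel₀ (sub_ne_zero.2 hyw) (by linear_combination e1 - e3)
  have h3 : c₃ = 0 := mul_left_cancel₀ (sub_ne_zero.2 hzw) (by linear_combination f1 - f2)
  subst h3
  have h2 : c₂ = 0 := by linear_combination f1
  subst h2
  have h1 : c₁ = 0 := by linear_combination e1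
  subst h1
  exact ⟨by linear_combination hx, rfl, rfl, rfl⟩

theorem quadratic_coeffs_eq_zero {F : Type*} [Field F] {x y z c₀ c₁ c₂ : F}
    (hxy : x ≠ y) (hxz : x ≠ z) (hyz : y ≠ z)
    (hx : c₀ + c₁ * x + c₂ * x ^ 2 = 0)
    (hy : c₀ + c₁ * y + c₂ * y ^ 2 = 0)
    (hz : c₀ + c₁ * z + c₂ * z ^ 2 = 0) :
    c₀ = 0 ∧ c₁ = 0 ∧ c₂ = 0 := by
  have e1 : c₁ + c₂ * (x + y) = 0 :=
    mul_left_cancel₀ (sub_ne_zero.2 hxy) (by linear_combination hx - hy)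
  have e2 : c₁ + c₂ * (x + z) = 0 :=
    mul_left_cancel₀ (sub_ne_zero.2 hxz) (by linear_combination hx - hz)
  have h2 : c₂ = 0 := mul_left_cancel₀ (sub_ne_zero.2 hyz) (by linear_combination e1 - e2)
  subst h2
  have h1 : c₁ = 0 := by linear_combination e1
  subst h1
  exact ⟨by linear_combination hx, rfl, rfl⟩

/-- The graph of a cubic is a Sidon set away from the chord sum `-2 * c₂ / (3 * c₃)`. -/
theorem sidon_of_cubic {F : Type*} [Field F] {x y z w c₀ c₁ c₂ c₃ : F}
    (h1 : x + y = z + w) (hne : 3 * c₃ * (x + y) + 2 * c₂ ≠ 0)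
    (h2 : (c₀ + c₁ * x + c₂ * x ^ 2 + c₃ * x ^ 3) + (c₀ + c₁ * y + c₂ * y ^ 2 + c₃ * y ^ 3) =
      (c₀ + c₁ * z + c₂ * z ^ 2 + c₃ * z ^ 3) + (c₀ + c₁ * w + c₂ * w ^ 2 + c₃ * w ^ 3)) :
    (x = z ∧ y = w) ∨ (x = w ∧ y = z) := by
  obtain rfl : y = z + w - x := by linear_combination h1
  have h3 : (3 * c₃ * (x + (z + w - x)) + 2 * c₂) * ((x - z) * (x - w)) = 0 := by
    linear_combination h2
  rcases mul_eq_zero.1 ((mul_eq_zero.1 h3).resolve_left hne) with h | h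
  · left; exact ⟨by linear_combination h, by linear_combination -h⟩
  · right; exact ⟨by linear_combination h, by linear_combination -h⟩

/-- A half of the nonzero residues containing no two elements with sum zero. -/
def lowerHalf (r : ℕ) [NeZero r] : Finset (ZMod r) :=
  {h ∈ univ | 0 < h.val ∧ 2 * h.val < r}

theorem add_ne_zero_of_mem_lowerHalf {r : ℕ} [NeZero r] {h k : ZMod r} (hh : h ∈ lowerHalf r)
    (hk : k ∈ lowerHalf r) : h + k ≠ 0 := by
  simp only [lowerHalf, mem_filter, mem_univ, true_and] at hh hk
  intro h0
  have := congrArg ZMod.val h0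
  rw [ZMod.val_add_of_lt (by omega), ZMod.val_zero] at this
  omega

theorem le_four_mul_card_lowerHalf {r : ℕ} [Fact r.Prime] (hr : 2 < r) :
    r ≤ 4 * #(lowerHalf r) := by
  classical
  have hsub : (univ : Finset (ZMod r)) ⊆
      insert 0 (lowerHalf r ∪ (lowerHalf r).image (fun x => -x)) := by
    intro x _
    rw [mem_insert, mem_union, mem_image]
    by_cases hx : x = 0
    · exact Or.inl hx
    right
    have hv : 0 < x.val := Nat.pos_of_ne_zero (by rwa [Ne, ZMod.val_eq_zero])
    have hodd : r % 2 = 1 := ((Fact.out : r.Prime).eq_two_or_odd).resolve_left (by omega)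
    have hlt := ZMod.val_lt x
    by_cases h2 : 2 * x.val < r
    · left; exact mem_filter.2 ⟨mem_univ _, hv, h2⟩
    · right
      refine ⟨-x, ?_, neg_neg x⟩
      have : NeZero x := ⟨hx⟩
      simp only [lowerHalf, mem_filter, mem_univ, true_and, ZMod.val_neg_of_ne_zero]
      omega
  have h1 := card_le_card hsub
  have h2 := card_insert_le (0 : ZMod r) (lowerHalf r ∪ (lowerHalf r).image (fun x => -x))
  have h3 := card_union_le (lowerHalf r) ((lowerHalf r).image (fun x => -x))
  have h4 := card_image_le (s := lowerHalf r) (f := fun x => -x)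
  rw [card_univ, ZMod.card] at h1
  omega

/-- Intersecting with the graph of a random cubic gives a large Sidon subset that avoids most of
the prescribed triples and quadruples. -/
theorem exists_sidon_subset_avoiding {α : Type*} [DecidableEq α] {r : ℕ} [Fact r.Prime]
    (hr : 2 < r) (B : Finset α) (φ ψ : α → ZMod r)
    (hinj : ∀ a ∈ B, ∀ b ∈ B, φ a = φ b → ψ a = ψ b → a = b)
    (T₄ : Finset (α × α × α × α)) (T₃ : Finset (α × α × α))
    (hT₄ : ∀ t ∈ T₄, t.1 ∈ B ∧ t.2.1 ∈ B ∧ t.2.2.1 ∈ B ∧ t.2.2.2 ∈ B ∧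
      t.1 ≠ t.2.1 ∧ t.1 ≠ t.2.2.1 ∧ t.1 ≠ t.2.2.2 ∧ t.2.1 ≠ t.2.2.1 ∧ t.2.1 ≠ t.2.2.2 ∧
      t.2.2.1 ≠ t.2.2.2)
    (hT₃ : ∀ t ∈ T₃, t.1 ∈ B ∧ t.2.1 ∈ B ∧ t.2.2 ∈ B ∧
      t.1 ≠ t.2.1 ∧ t.1 ≠ t.2.2 ∧ t.2.1 ≠ t.2.2) :
    ∃ S ⊆ B, (∀ a ∈ S, ∀ b ∈ S, ∀ c ∈ S, ∀ d ∈ S, φ a + φ b = φ c + φ d → ψ a + ψ b = ψ c + ψ d →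
        (a = c ∧ b = d) ∨ (a = d ∧ b = c)) ∧
      (∀ t ∈ T₄, ¬ (t.1 ∈ S ∧ t.2.1 ∈ S ∧ t.2.2.1 ∈ S ∧ t.2.2.2 ∈ S)) ∧
      (∀ t ∈ T₃, ¬ (t.1 ∈ S ∧ t.2.1 ∈ S ∧ t.2.2 ∈ S)) ∧
      #B * r ^ 3 ≤ 4 * (#S * r ^ 4 + #T₄ + #T₃ * r) := by
  classical
  let P : (ZMod r × ZMod r × ZMod r × ZMod r) → α → Prop := fun c a =>
    ψ a = c.1 + c.2.1 * φ a + c.2.2.1 * φ a ^ 2 + c.2.2.2 * φ a ^ 3 ∧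
      3 * c.2.2.2 * φ a + c.2.2.1 ∈ lowerHalf r
  let S' : (ZMod r × ZMod r × ZMod r × ZMod r) → Finset α := fun c => {a ∈ B | P c a}
  let D₄ : (ZMod r × ZMod r × ZMod r × ZMod r) → Finset (α × α × α × α) := fun c =>
    {t ∈ T₄ | P c t.1 ∧ P c t.2.1 ∧ P c t.2.2.1 ∧ P c t.2.2.2}
  let D₃ : (ZMod r × ZMod r × ZMod r × ZMod r) → Finset (α × α × α) := fun c =>
    {t ∈ T₃ | P c t.1 ∧ P c t.2.1 ∧ P c t.2.2}
  have hphi : ∀ c a b, a ∈ B → b ∈ B → P c a → P c b → a ≠ b → φ a ≠ φ b := by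
    intro c a b ha hb h1 h2 hab h
    refine hab (hinj a ha b hb h ?_)
    rw [h1.1, h2.1, h]
  have hS : #B * r ^ 3 ≤ 4 * ∑ c, #(S' c) := by
    have : ∑ c, #(S' c) = ∑ a ∈ B, #{c | P c a} :=
      sum_card_bipartiteAbove_eq_sum_card_bipartiteBelow _
    rw [this, mul_sum, ← smul_eq_mul, ← sum_const]
    refine sum_le_sum fun a _ => ?_
    have h1 : #(lowerHalf r ×ˢ (univ : Finset (ZMod r × ZMod r))) ≤ #{c | P c a} := by
      refine card_le_card_of_injOn (fun x => (ψ a - x.2.1 * φ a - (x.1 - 3 * x.2.2 * φ a) * φ a ^ 2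
        - x.2.2 * φ a ^ 3, x.2.1, x.1 - 3 * x.2.2 * φ a, x.2.2)) ?_ ?_
      · rintro ⟨h, c1, c3⟩ hx
        simp only [coe_product, Set.mem_prod, mem_coe] at hx
        simp only [coe_filter, mem_univ, true_and, Set.mem_ofPred_eq, P]
        refine ⟨by ring, ?_⟩
        convert hx.1 using 1
        ring
      · rintro ⟨h, c1, c3⟩ - ⟨h', c1', c3'⟩ - heq
        simp only [Prod.mk.injEq] at heq
        obtain ⟨-, rfl, h2, rfl⟩ := heq
        simpa using h2
    rw [card_product, card_univ, Fintype.card_prod, ZMod.card] at h1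
    have h2 := le_four_mul_card_lowerHalf hr
    calc r ^ 3 = r * (r * r) := by ring
      _ ≤ 4 * #(lowerHalf r) * (r * r) := Nat.mul_le_mul_right _ h2
      _ ≤ _ := by rw [mul_assoc]; exact Nat.mul_le_mul_left _ h1
  have hD₄ : ∑ c, #(D₄ c) ≤ #T₄ := by
    have : ∑ c, #(D₄ c) = ∑ t ∈ T₄, #{c | P c t.1 ∧ P c t.2.1 ∧ P c t.2.2.1 ∧ P c t.2.2.2} :=
      sum_card_bipartiteAbove_eq_sum_card_bipartiteBelow _
    rw [this, card_eq_sum_ones]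
    refine sum_le_sum fun t ht => card_le_one.2 ?_
    obtain ⟨m1, m2, m3, m4, n12, n13, n14, n23, n24, n34⟩ := hT₄ t ht
    intro c hc d hd
    simp only [mem_filter, mem_univ, true_and] at hc hd
    obtain ⟨p1, p2, p3, p4⟩ := hc
    obtain ⟨q1, q2, q3, q4⟩ := hd
    obtain ⟨z0, z1, z2, z3⟩ := cubic_coeffs_eq_zero (c₀ := c.1 - d.1) (c₁ := c.2.1 - d.2.1)
      (c₂ := c.2.2.1 - d.2.2.1) (c₃ := c.2.2.2 - d.2.2.2)
      (hphi c _ _ m1 m2 p1 p2 n12) (hphi c _ _ m1 m3 p1 p3 n13) (hphi c _ _ m1 m4 p1 p4 n14)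
      (hphi c _ _ m2 m3 p2 p3 n23) (hphi c _ _ m2 m4 p2 p4 n24) (hphi c _ _ m3 m4 p3 p4 n34)
      (by linear_combination q1.1 - p1.1) (by linear_combination q2.1 - p2.1)
      (by linear_combination q3.1 - p3.1) (by linear_combination q4.1 - p4.1)
    exact Prod.ext (sub_eq_zero.1 z0) (Prod.ext (sub_eq_zero.1 z1)
      (Prod.ext (sub_eq_zero.1 z2) (sub_eq_zero.1 z3)))
  have hD₃ : ∑ c, #(D₃ c) ≤ #T₃ * r := by
    have : ∑ c, #(D₃ c) = ∑ t ∈ T₃, #{c | P c t.1 ∧ P c t.2.1 ∧ P c t.2.2} :=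
      sum_card_bipartiteAbove_eq_sum_card_bipartiteBelow _
    rw [this, ← smul_eq_mul, ← sum_const]
    refine sum_le_sum fun t ht => ?_
    obtain ⟨m1, m2, m3, n12, n13, n23⟩ := hT₃ t ht
    refine le_of_le_of_eq (b := #(univ : Finset (ZMod r))) ?_ (by rw [card_univ, ZMod.card])
    refine card_le_card_of_injOn (fun c => c.2.2.2) (fun _ _ => by simp) ?_
    intro c hc d hd heq
    simp only [coe_filter, mem_univ, true_and, Set.mem_ofPred_eq] at hc hd
    obtain ⟨p1, p2, p3⟩ := hc
    obtain ⟨q1, q2, q3⟩ := hd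
    replace heq : c.2.2.2 = d.2.2.2 := heq
    obtain ⟨z0, z1, z2⟩ := quadratic_coeffs_eq_zero (c₀ := c.1 - d.1) (c₁ := c.2.1 - d.2.1)
      (c₂ := c.2.2.1 - d.2.2.1)
      (hphi c _ _ m1 m2 p1 p2 n12) (hphi c _ _ m1 m3 p1 p3 n13) (hphi c _ _ m2 m3 p2 p3 n23)
      (by linear_combination q1.1 - p1.1 - φ t.1 ^ 3 * heq)
      (by linear_combination q2.1 - p2.1 - φ t.2.1 ^ 3 * heq)
      (by linear_combination q3.1 - p3.1 - φ t.2.2 ^ 3 * heq)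
    exact Prod.ext (sub_eq_zero.1 z0) (Prod.ext (sub_eq_zero.1 z1)
      (Prod.ext (sub_eq_zero.1 z2) heq))
  obtain ⟨c, hc⟩ : ∃ c, #B * r ^ 3 + 4 * r ^ 4 * (#(D₄ c) + #(D₃ c)) ≤
      4 * (#(S' c) * r ^ 4 + #T₄ + #T₃ * r) := by
    by_contra! hcon
    have h1 : ∑ c, 4 * (#(S' c) * r ^ 4 + #T₄ + #T₃ * r) <
        ∑ c, (#B * r ^ 3 + 4 * r ^ 4 * (#(D₄ c) + #(D₃ c))) :=
      sum_lt_sum_of_nonempty univ_nonempty fun c _ => hcon c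
    simp only [← mul_sum, sum_add_distrib, ← sum_mul] at h1
    simp only [sum_const, card_univ, Fintype.card_prod, ZMod.card, smul_eq_mul] at h1
    have e : r * (r * (r * r)) = r ^ 4 := by ring
    rw [e] at h1
    have h2 : r ^ 4 * (#B * r ^ 3) ≤ r ^ 4 * (4 * ∑ c, #(S' c)) := Nat.mul_le_mul_left _ hS
    have h3 : r ^ 4 * (∑ c, #(D₄ c) + ∑ c, #(D₃ c)) ≤ r ^ 4 * (#T₄ + #T₃ * r) :=
      Nat.mul_le_mul_left _ (add_le_add hD₄ hD₃)
    nlinarith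
  refine ⟨S' c \ ((D₄ c).image Prod.fst ∪ (D₃ c).image Prod.fst),
    sdiff_subset.trans (filter_subset _ _), ?_, ?_, ?_, ?_⟩
  · have hP : ∀ x ∈ S' c \ ((D₄ c).image Prod.fst ∪ (D₃ c).image Prod.fst), x ∈ B ∧ P c x :=
      fun x hx => mem_filter.1 (mem_sdiff.1 hx).1
    intro x hx y hy z hz w hw h1 h2
    obtain ⟨bx, px⟩ := hP x hx
    obtain ⟨bY, py⟩ := hP y hy
    obtain ⟨bz, pz⟩ := hP z hz
    obtain ⟨bw, pw⟩ := hP w hw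
    have hne : 3 * c.2.2.2 * (φ x + φ y) + 2 * c.2.2.1 ≠ 0 := by
      have := add_ne_zero_of_mem_lowerHalf px.2 py.2
      intro h
      apply this
      linear_combination h
    have hinj' : ∀ a b, a ∈ B → b ∈ B → P c a → P c b → φ a = φ b → a = b := by
      intro a b ha hb h1 h2 h
      by_contra hab
      exact hphi c a b ha hb h1 h2 hab h
    rw [px.1, py.1, pz.1, pw.1] at h2
    rcases sidon_of_cubic h1 hne h2 with ⟨h, h'⟩ | ⟨h, h'⟩
    · exact Or.inl ⟨hinj' _ _ bx bz px pz h, hinj' _ _ bY bw py pw h'⟩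
    · exact Or.inr ⟨hinj' _ _ bx bw px pw h, hinj' _ _ bY bz py pz h'⟩
  · rintro t ht ⟨h1, h2, h3, h4⟩
    rw [mem_sdiff] at h1 h2 h3 h4
    refine h1.2 (mem_union_left _ (mem_image_of_mem _ (mem_filter.2 ⟨ht, ?_⟩)))
    exact ⟨(mem_filter.1 h1.1).2, (mem_filter.1 h2.1).2, (mem_filter.1 h3.1).2,
      (mem_filter.1 h4.1).2⟩
  · rintro t ht ⟨h1, h2, h3⟩
    rw [mem_sdiff] at h1 h2 h3
    refine h1.2 (mem_union_right _ (mem_image_of_mem _ (mem_filter.2 ⟨ht, ?_⟩)))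
    exact ⟨(mem_filter.1 h1.1).2, (mem_filter.1 h2.1).2, (mem_filter.1 h3.1).2⟩
  · have h1 := le_card_sdiff ((D₄ c).image Prod.fst ∪ (D₃ c).image Prod.fst) (S' c)
    have h2 := card_union_le ((D₄ c).image Prod.fst) ((D₃ c).image Prod.fst)
    have h3 := card_image_le (s := D₄ c) (f := Prod.fst)
    have h4 := card_image_le (s := D₃ c) (f := Prod.fst)
    have h5 : #(S' c) ≤ #(S' c \ ((D₄ c).image Prod.fst ∪ (D₃ c).image Prod.fst)) +
      (#(D₄ c) + #(D₃ c)) := by omega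
    have h6 := Nat.mul_le_mul_right (r ^ 4) h5
    nlinarith

/-- The solutions of `g a + g b = g c + g d` with variables in `B`. -/
def sumQuads {α G : Type*} [DecidableEq G] [Add G] (B : Finset α) (g : α → G) :
    Finset (α × α × α × α) :=
  {t ∈ B ×ˢ B ×ˢ B ×ˢ B | g t.1 + g t.2.1 = g t.2.2.1 + g t.2.2.2}

/-- The image of `S` under `f` is a Sidon set, and `f` is injective on `S`. -/
def SidonVia {α G : Type*} [Add G] (S : Finset α) (f : α → G) : Prop :=
  ∀ a ∈ S, ∀ b ∈ S, ∀ c ∈ S, ∀ d ∈ S, f a + f b = f c + f d → (a = c ∧ b = d) ∨ (a = d ∧ b = c)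

theorem exists_sidonVia_of_card_sumQuads_le {α : Type*} {q q' r : ℕ}
    [Fact q.Prime] [Fact q'.Prime] [Fact r.Prime] (hq' : q' ≠ 2) (hr2 : 2 < r) (B : Finset α)
    (f : α → ZMod q) (g : α → ZMod q') (hf : Set.InjOn f B) (hg : Set.InjOn g B)
    (hr : 256 * #B ≤ r ^ 2) (hE : 256 * #(sumQuads B g) ≤ #B * r ^ 3) :
    ∃ S ⊆ B, SidonVia S f ∧ SidonVia S g ∧ #B ≤ 128 * (#S * r) := by
  classical
  have h2 : (2 : ZMod q') ≠ 0 := by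
    intro h
    have h' : ((2 : ℕ) : ZMod q') = 0 := by exact_mod_cast h
    rw [ZMod.natCast_eq_zero_iff] at h'
    exact hq' ((Nat.prime_dvd_prime_iff_eq Fact.out Nat.prime_two).1 h')
  obtain ⟨B₀, hB₀, hcard, φ, ψ, hlt, hinj, hhom⟩ :=
    exists_digit_map B f hf r (by omega) (by omega)
  let T₄ : Finset (α × α × α × α) := {t ∈ sumQuads B₀ g |
      t.1 ≠ t.2.1 ∧ t.1 ≠ t.2.2.1 ∧ t.1 ≠ t.2.2.2 ∧ t.2.1 ≠ t.2.2.1 ∧ t.2.1 ≠ t.2.2.2 ∧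
      t.2.2.1 ≠ t.2.2.2}
  let T₃ : Finset (α × α × α) := {t ∈ B₀ ×ˢ B₀ ×ˢ B₀ | g t.1 + g t.1 = g t.2.1 + g t.2.2 ∧
      t.1 ≠ t.2.1 ∧ t.1 ≠ t.2.2 ∧ t.2.1 ≠ t.2.2}
  have hT₄ : #T₄ ≤ #(sumQuads B g) := by
    refine card_le_card ((filter_subset _ _).trans ?_)
    exact filter_subset_filter _ (product_subset_product hB₀ (product_subset_product hB₀
      (product_subset_product hB₀ hB₀)))
  have hT₃ : #T₃ ≤ #B * #B := by
    rw [← card_product]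
    refine card_le_card_of_injOn (fun t => (t.1, t.2.1)) ?_ ?_
    · intro t ht
      simp only [T₃, coe_filter, mem_product, Set.mem_ofPred_eq] at ht
      simp [hB₀ ht.1.1, hB₀ ht.1.2.1]
    · rintro ⟨a, c, d⟩ ht ⟨a', c', d'⟩ ht' heq
      simp only [T₃, coe_filter, mem_product, Set.mem_ofPred_eq] at ht ht'
      simp only [Prod.mk.injEq] at heq
      obtain ⟨rfl, rfl⟩ := heq
      have : g d = g d' := add_left_cancel (ht.2.1.symm.trans ht'.2.1)
      rw [hg (hB₀ ht.1.2.2) (hB₀ ht'.1.2.2) this]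
  obtain ⟨S, hS, hsid, h4, h3, hbound⟩ := exists_sidon_subset_avoiding hr2 B₀
    (fun a => (φ a : ZMod r)) (fun a => (ψ a : ZMod r))
    (fun a ha b hb h1 h2 => hinj a ha b hb
      (by simpa [ZMod.natCast_eq_natCast_iff', Nat.mod_eq_of_lt, hlt a ha, hlt b hb] using h1)
      (by simpa [ZMod.natCast_eq_natCast_iff', Nat.mod_eq_of_lt, hlt a ha, hlt b hb] using h2))
    T₄ T₃
    (by
      intro t ht
      simp only [T₄, sumQuads, mem_filter, mem_product] at ht
      tauto)
    (by
      intro t ht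
      simp only [T₃, mem_filter, mem_product] at ht
      tauto)
  refine ⟨S, hS.trans hB₀, ?_, ?_, ?_⟩
  · intro a ha b hb c hc d hd h
    obtain ⟨h1, h2⟩ := hhom a (hS ha) b (hS hb) c (hS hc) d (hS hd) h
    exact hsid a ha b hb c hc d hd (by exact_mod_cast congrArg (Nat.cast : ℕ → ZMod r) h1)
      (by exact_mod_cast congrArg (Nat.cast : ℕ → ZMod r) h2)
  · intro a ha b hb c hc d hd h
    have inj : ∀ x ∈ S, ∀ y ∈ S, g x = g y → x = y := fun x hx y hy hxy =>
      hg (hB₀ (hS hx)) (hB₀ (hS hy)) hxy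
    by_cases hac : a = c
    · subst hac
      exact Or.inl ⟨rfl, inj b hb d hd (add_left_cancel h)⟩
    by_cases had : a = d
    · subst had
      exact Or.inr ⟨rfl, inj b hb c hc (by linear_combination h)⟩
    by_cases hbc : b = c
    · subst hbc
      exact absurd (inj a ha d hd (by linear_combination h)) had
    by_cases hbd : b = d
    · subst hbd
      exact absurd (inj a ha c hc (by linear_combination h)) hac
    exfalso
    by_cases hab : a = b
    · subst hab
      have hcd : c ≠ d := by
        rintro rfl
        exact hac (inj a ha c hc (mul_left_cancel₀ h2 (by linear_combination h)))
      exact h3 (a, c, d) (mem_filter.2 ⟨by simp [hS ha, hS hc, hS hd], h, hac, had, hcd⟩)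
        ⟨ha, hc, hd⟩
    by_cases hcd : c = d
    · subst hcd
      exact h3 (c, a, b) (mem_filter.2 ⟨by simp [hS ha, hS hc, hS hb], h.symm, Ne.symm hac,
        Ne.symm hbc, hab⟩) ⟨hc, ha, hb⟩
    exact h4 (a, b, c, d) (mem_filter.2 ⟨mem_filter.2 ⟨by simp [hS ha, hS hc, hS hb, hS hd], h⟩,
      hab, hac, had, hbc, hbd, hcd⟩) ⟨ha, hb, hc, hd⟩
  · have hr0 : 0 < r ^ 3 := by positivity
    have e1 : 256 * (#B * #B * r) ≤ #B * r ^ 3 := by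
      have := Nat.mul_le_mul_left (#B * r) hr
      nlinarith
    have e2 : #B * r ^ 3 ≤ 16 * (#B₀ * r ^ 3) := by
      have := Nat.mul_le_mul_right (r ^ 3) hcard
      nlinarith
    have e3 : #T₃ * r ≤ #B * #B * r := Nat.mul_le_mul_right _ hT₃
    have e4 : #B * r ^ 3 ≤ 128 * (#S * r) * r ^ 3 := by
      have : 128 * (#S * r) * r ^ 3 = 128 * (#S * r ^ 4) := by ring
      omega
    exact Nat.le_of_mul_le_mul_right e4 hr0

/-- The **Balog–Szemerédi–Gowers theorem**, in a finite abelian group. -/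
theorem balog_szemeredi_gowers {G : Type*} [AddCommGroup G] [Fintype G] [DecidableEq G]
    (A : Finset G) (hA : A.Nonempty) {K : ℝ} (hK : 1 ≤ K)
    (hE : (#A : ℝ) ^ 3 ≤
      K * #{t ∈ A ×ˢ A ×ˢ A ×ˢ A | t.1 + t.2.1 = t.2.2.1 + t.2.2.2}) :
    ∃ A' ⊆ A, (#A : ℝ) ≤ 8 * K * #A' ∧ (#(A' - A') : ℝ) ≤ 2 ^ 19 * K ^ 9 * #A := by
  classical
  have hN : (0 : ℝ) < #A := by exact_mod_cast hA.card_pos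
  have hK0 : 0 < K := zero_lt_one.trans_le hK
  obtain ⟨N, hNdef⟩ : ∃ N : ℝ, N = #A := ⟨_, rfl⟩
  rw [← hNdef] at hE hN ⊢
  have hNK : 0 ≤ N / (2 * K) := by positivity
  let r : G → ℝ := fun d => #{t ∈ A ×ˢ A | t.1 - t.2 = d}
  have hr0 : ∀ d, 0 ≤ r d := fun d => Nat.cast_nonneg _
  have hrN : ∀ d, r d ≤ N := by
    intro d
    rw [hNdef]
    refine Nat.cast_le.2 (card_le_card_of_injOn Prod.fst ?_ ?_)
    · intro t ht
      simp only [coe_filter, mem_product, Set.mem_ofPred_eq] at ht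
      exact ht.1.1
    · rintro ⟨x, y⟩ h ⟨x', y'⟩ h' heq
      simp only [coe_filter, mem_product, Set.mem_ofPred_eq] at h h' heq
      subst heq
      have := h.2.trans h'.2.symm
      simpa using this
  have hrsymm : ∀ a b, r (a - b) = r (b - a) := by
    intro a b
    refine Nat.cast_inj.2 (card_bij' (fun t _ => (t.2, t.1)) (fun t _ => (t.2, t.1)) ?_ ?_ ?_ ?_)
    · simp only [mem_filter, mem_product]
      rintro t ⟨⟨h1, h2⟩, h3⟩
      exact ⟨⟨h2, h1⟩, by rw [← neg_sub, h3, neg_sub]⟩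
    · simp only [mem_filter, mem_product]
      rintro t ⟨⟨h1, h2⟩, h3⟩
      exact ⟨⟨h2, h1⟩, by rw [← neg_sub, h3, neg_sub]⟩
    · simp
    · simp
  have hrsum : ∑ d, r d = N ^ 2 := by
    have := card_eq_sum_card_fiberwise (f := fun t : G × G => t.1 - t.2) (s := A ×ˢ A) (t := univ)
      (fun _ _ => by simp)
    rw [card_product] at this
    simp only [r]
    rw [← Nat.cast_sum, ← this, hNdef]
    push_cast
    ring
  -- the popularity graph
  let adj : G → G → Prop := fun a b => N / (2 * K) ≤ r (a - b)
  have hadj : ∀ a b, adj a b → adj b a := fun a b h => by simp only [adj] at h ⊢; rwa [hrsymm b a]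
  have hEsum : (#{t ∈ A ×ˢ A ×ˢ A ×ˢ A | t.1 + t.2.1 = t.2.2.1 + t.2.2.2} : ℝ)
      = ∑ t ∈ A ×ˢ A, r (t.1 - t.2) := by
    have := card_eq_sum_card_fiberwise
      (f := fun t : G × G × G × G => (t.1, t.2.2.1))
      (s := {t ∈ A ×ˢ A ×ˢ A ×ˢ A | t.1 + t.2.1 = t.2.2.1 + t.2.2.2}) (t := A ×ˢ A) (by
        intro t ht
        simp only [coe_filter, mem_product, Set.mem_ofPred_eq] at ht
        simp [ht.1.1, ht.1.2.2.1])
    rw [this, Nat.cast_sum]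
    refine sum_congr rfl fun t ht => ?_
    rw [mem_product] at ht
    refine Nat.cast_inj.2 (card_bij' (fun s _ => (s.2.2.2, s.2.1))
      (fun s _ => (t.1, s.2, t.2, s.1)) ?_ ?_ ?_ ?_)
    · rintro ⟨a, b, c, d⟩ h
      simp only [mem_filter, mem_product] at h ⊢
      obtain ⟨⟨⟨h1, h2, h3, h4⟩, h5⟩, rfl⟩ := h
      refine ⟨⟨h4, h2⟩, ?_⟩
      rw [sub_eq_sub_iff_add_eq_add, add_comm d c, ← h5]
    · rintro ⟨x, y⟩ h
      simp only [mem_filter, mem_product] at h ⊢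
      refine ⟨⟨⟨ht.1, h.1.2, ht.2, h.1.1⟩, ?_⟩, trivial⟩
      rw [sub_eq_sub_iff_add_eq_add] at h
      rw [← h.2, add_comm]
    · rintro ⟨a, b, c, d⟩ h
      simp only [mem_filter] at h
      obtain ⟨_, rfl⟩ := h
      rfl
    · simp
  let Γ : G → Finset G := fun v => {a ∈ A | adj a v}
  have hedge : N ^ 2 ≤ 2 * K * ∑ v ∈ A, (#(Γ v) : ℝ) := by
    have h1 : ∑ t ∈ A ×ˢ A, r (t.1 - t.2) ≤ ∑ v ∈ A, (N * #(Γ v) + N * (N / (2 * K))) := by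
      rw [sum_product_right]
      refine sum_le_sum fun v _ => ?_
      calc ∑ a ∈ A, r (a - v) ≤ ∑ a ∈ A, ((if adj a v then N else 0) + N / (2 * K)) := by
            refine sum_le_sum fun a _ => ?_
            split_ifs with h
            · have := hrN (a - v)
              have : 0 ≤ N / (2 * K) := by positivity
              linarith
            · simp only [adj, not_le] at h
              linarith
        _ = N * #(Γ v) + N * (N / (2 * K)) := by
            rw [sum_add_distrib, ← sum_filter, sum_const, sum_const, nsmul_eq_mul, nsmul_eq_mul, ← hNdef]
            simp only [Γ]
            ring
    rw [sum_add_distrib, ← mul_sum, sum_const, nsmul_eq_mul, ← hNdef] at h1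
    rw [hEsum] at hE
    have h2 : N ^ 3 ≤ K * (N * ∑ v ∈ A, (#(Γ v) : ℝ) + N * (N * (N / (2 * K)))) :=
      hE.trans (mul_le_mul_of_nonneg_left h1 (by positivity))
    have h3 : K * (N * ∑ v ∈ A, (#(Γ v) : ℝ) + N * (N * (N / (2 * K)))) =
      K * N * ∑ v ∈ A, (#(Γ v) : ℝ) + N ^ 3 / 2 := by
      have : K * (N / (2 * K)) = N / 2 := by
        rw [mul_div_assoc', mul_comm K N, mul_comm 2 K, mul_comm N K,
          mul_div_mul_left _ _ (by positivity)]
      linear_combination N ^ 2 * this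
    have h4 : N * N ^ 2 ≤ N * (2 * K * ∑ v ∈ A, (#(Γ v) : ℝ)) := by linarith
    exact le_of_mul_le_mul_left h4 hN
  let bad : G → G → Prop := fun a b => (#{v ∈ A | adj a v ∧ adj b v} : ℝ) < N / (64 * K ^ 2)
  have hbadsymm : ∀ a b, bad a b → bad b a := by
    intro a b h
    simp only [bad] at h ⊢
    simpa only [and_comm] using h
  let D : G → Finset (G × G) := fun v => {t ∈ A ×ˢ A | bad t.1 t.2 ∧ adj t.1 v ∧ adj t.2 v}
  have hDsum : ∑ v ∈ A, (#(D v) : ℝ) ≤ N ^ 2 * (N / (64 * K ^ 2)) := by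
    have h1 : ∑ v ∈ A, #(D v) = ∑ t ∈ A ×ˢ A, #{v ∈ A | bad t.1 t.2 ∧ adj t.1 v ∧ adj t.2 v} :=
      sum_card_bipartiteAbove_eq_sum_card_bipartiteBelow _
    rw [← Nat.cast_sum, h1, Nat.cast_sum]
    have h2 : N ^ 2 = (#(A ×ˢ A) : ℝ) := by rw [card_product, hNdef]; push_cast; ring
    rw [h2, ← nsmul_eq_mul, ← sum_const]
    refine sum_le_sum fun t _ => ?_
    by_cases hb : bad t.1 t.2
    · simp only [hb, true_and]
      exact hb.le
    · simp only [hb, false_and, filter_false, card_empty, Nat.cast_zero]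
      positivity
  obtain ⟨v, -, hv⟩ : ∃ v ∈ A, N ^ 2 / (8 * K ^ 2) ≤ (#(Γ v) : ℝ) ^ 2 - 8 * #(D v) := by
    apply exists_le_of_sum_le hA
    rw [sum_sub_distrib, ← mul_sum, sum_const, nsmul_eq_mul]
    have hcs := sq_sum_le_card_mul_sum_sq (s := A) (f := fun v => (#(Γ v) : ℝ))
    rw [← hNdef] at hcs
    have h1 : (N ^ 2) ^ 2 ≤ (2 * K * ∑ v ∈ A, (#(Γ v) : ℝ)) ^ 2 := by gcongr
    have h2 : N * N ^ 3 ≤ N * (4 * K ^ 2 * ∑ v ∈ A, (#(Γ v) : ℝ) ^ 2) := by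
      calc N * N ^ 3 = (N ^ 2) ^ 2 := by ring
        _ ≤ _ := h1
        _ = 4 * K ^ 2 * (∑ v ∈ A, (#(Γ v) : ℝ)) ^ 2 := by ring
        _ ≤ 4 * K ^ 2 * (N * ∑ v ∈ A, (#(Γ v) : ℝ) ^ 2) := by gcongr
        _ = _ := by ring
    have h3 := le_of_mul_le_mul_left h2 hN
    have h4 : N ^ 3 / (4 * K ^ 2) ≤ ∑ v ∈ A, (#(Γ v) : ℝ) ^ 2 := by
      rw [div_le_iff₀ (by positivity)]; linarith
    have h5 : N * (N ^ 2 / (8 * K ^ 2)) = N ^ 3 / (4 * K ^ 2) - 8 * (N ^ 2 * (N / (64 * K ^ 2))) := by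
      field_simp; ring
    rw [← hNdef, h5]
    linarith
  obtain ⟨g, hg⟩ : ∃ g : ℝ, g = #(Γ v) := ⟨_, rfl⟩
  rw [← hg] at hv
  have hDnn : (0 : ℝ) ≤ #(D v) := Nat.cast_nonneg _
  have hgnn : 0 ≤ g := hg ▸ Nat.cast_nonneg _
  have hgN : N ≤ 4 * K * g := by
    have h1 : N ^ 2 / (8 * K ^ 2) ≤ g ^ 2 := by linarith
    rw [div_le_iff₀ (by positivity)] at h1
    refine abs_le_of_sq_le_sq' (a := N) (b := 4 * K * g) ?_ (by positivity) |>.2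
    nlinarith [sq_nonneg (K * g)]
  have hg0 : 0 < g := by
    by_contra! h
    have : 4 * K * g ≤ 0 := mul_nonpos_of_nonneg_of_nonpos (by positivity) h
    linarith
  have hDg : 8 * (#(D v) : ℝ) ≤ g ^ 2 := by
    have : 0 ≤ N ^ 2 / (8 * K ^ 2) := by positivity
    linarith
  set A' : Finset G := {a ∈ Γ v | (#{b ∈ Γ v | bad a b} : ℝ) ≤ g / 4} with hA'
  have hA'sub : A' ⊆ Γ v := filter_subset _ _
  have hΓA : Γ v ⊆ A := filter_subset _ _
  have hA'g : g ≤ 2 * #A' := by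
    have h1 : (#(Γ v \ A') : ℝ) * (g / 4) ≤ #(D v) := by
      have e : #(D v) = ∑ a ∈ Γ v, #{b ∈ Γ v | bad a b} := by
        have := card_eq_sum_card_fiberwise (f := Prod.fst) (s := D v) (t := Γ v) (by
          intro t ht
          simp only [D, coe_filter, mem_product, Set.mem_ofPred_eq] at ht
          simp [Γ, ht.1.1, ht.2.2.1])
        rw [this]
        refine sum_congr rfl fun a ha => ?_
        refine card_bij' (fun t _ => t.2) (fun b _ => (a, b)) ?_ ?_ ?_ ?_
        · rintro ⟨x, y⟩ h
          simp only [D, Γ, mem_filter, mem_product] at h ⊢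
          obtain ⟨h, rfl⟩ := h
          exact ⟨⟨h.1.2, h.2.2.2⟩, h.2.1⟩
        · intro b h
          simp only [D, Γ, mem_filter, mem_product] at h ha ⊢
          exact ⟨⟨⟨ha.1, h.1.1⟩, h.2, ha.2, h.1.2⟩, trivial⟩
        · rintro ⟨x, y⟩ h
          simp only [mem_filter] at h
          simp [h.2]
        · simp
      rw [e, Nat.cast_sum, ← nsmul_eq_mul, ← sum_const]
      refine (sum_le_sum fun a ha => ?_).trans
        (sum_le_sum_of_subset_of_nonneg sdiff_subset fun _ _ _ => Nat.cast_nonneg _)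
      rw [mem_sdiff] at ha
      by_contra! hlt
      exact ha.2 (mem_filter.2 ⟨ha.1, hlt.le⟩)
    have h2 : (#(Γ v \ A') : ℝ) + #A' = g := by
      rw [hg, ← card_sdiff_add_card_eq_card hA'sub]; push_cast; ring
    have h3 : g * (#(Γ v \ A') : ℝ) ≤ g * (g / 2) := by nlinarith
    have h4 := le_of_mul_le_mul_left h3 hg0
    linarith
  -- convolution powers
  let conv : (G → ℝ) → (G → ℝ) → G → ℝ := fun s t d => ∑ e, s e * t (d - e)
  have hconv_lower : ∀ (s t : G → ℝ) (hs : ∀ d, 0 ≤ s d) (ht : ∀ d, 0 ≤ t d) (W : Finset G)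
      (a b : G) (x : ℝ), (∀ w ∈ W, x ≤ s (a - w) * t (w - b)) → #W * x ≤ conv s t (a - b) := by
    intro s t hs ht W a b x h
    have h1 : ∑ w ∈ W, s (a - w) * t (w - b) = ∑ e ∈ W.image (fun w => a - w),
        s e * t (a - b - e) := by
      rw [sum_image (by intro x _ y _ h; simpa using h)]
      refine sum_congr rfl fun w _ => ?_
      congr 2
      abel
    rw [← nsmul_eq_mul, ← sum_const]
    refine (sum_le_sum h).trans (h1.le.trans ?_)
    exact sum_le_sum_of_subset_of_nonneg (subset_univ _) fun e _ _ => mul_nonneg (hs _) (ht _)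
  have hconv_sum : ∀ s t : G → ℝ, ∑ d, conv s t d = (∑ d, s d) * ∑ d, t d := by
    intro s t
    simp only [conv]
    rw [sum_comm, sum_mul]
    refine sum_congr rfl fun e _ => ?_
    rw [← mul_sum]
    congr 1
    exact Fintype.sum_equiv (Equiv.subRight e) _ _ fun _ => rfl
  have hconv_nonneg : ∀ s t : G → ℝ, (∀ d, 0 ≤ s d) → (∀ d, 0 ≤ t d) → ∀ d, 0 ≤ conv s t d :=
    fun s t hs ht d => sum_nonneg fun e _ => mul_nonneg (hs _) (ht _)
  have hNK' : 0 ≤ N ^ 3 / (256 * K ^ 4) := by positivity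
  let r₂ := conv r r
  have hr₂0 := hconv_nonneg r r hr0 hr0
  have hgood : ∀ a b, ¬ bad a b → N ^ 3 / (256 * K ^ 4) ≤ r₂ (a - b) := by
    intro a b h
    simp only [bad, not_lt] at h
    have h1 := hconv_lower r r hr0 hr0 {v ∈ A | adj a v ∧ adj b v} a b
      ((N / (2 * K)) * (N / (2 * K))) (by
        intro w hw
        rw [mem_filter] at hw
        exact mul_le_mul hw.2.1 (hadj _ _ hw.2.2) hNK (hr0 _))
    refine le_trans ?_ h1
    calc N ^ 3 / (256 * K ^ 4) = N / (64 * K ^ 2) * ((N / (2 * K)) * (N / (2 * K))) := by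
          rw [div_mul_div_comm, div_mul_div_comm]; congr 1 <;> ring
      _ ≤ _ := by gcongr
  have hpop : ∀ a ∈ A', ∀ b ∈ A', N ^ 7 / (2 ^ 19 * K ^ 9) ≤ conv r₂ r₂ (a - b) := by
    intro a ha b hb
    rw [hA', mem_filter] at ha hb
    set W : Finset G := (Γ v \ {c ∈ Γ v | bad a c}) \ {c ∈ Γ v | bad b c} with hW
    have hWcard : N / (8 * K) ≤ #W := by
      have h1 := le_card_sdiff {c ∈ Γ v | bad a c} (Γ v)
      have h2 := le_card_sdiff {c ∈ Γ v | bad b c} (Γ v \ {c ∈ Γ v | bad a c})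
      rw [← hW] at h2
      have h3 : (#(Γ v) : ℝ) ≤ #W + #{c ∈ Γ v | bad a c} + #{c ∈ Γ v | bad b c} := by
        exact_mod_cast (by omega : #(Γ v) ≤ #W + #{c ∈ Γ v | bad a c} + #{c ∈ Γ v | bad b c})
      have h4 : g / 2 ≤ #W := by linarith [ha.2, hb.2]
      refine le_trans ?_ h4
      rw [div_le_iff₀ (by positivity)]
      linarith
    have h1 := hconv_lower r₂ r₂ hr₂0 hr₂0 W a b
      ((N ^ 3 / (256 * K ^ 4)) * (N ^ 3 / (256 * K ^ 4))) (by
        intro w hw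
        simp only [hW, mem_sdiff, mem_filter, not_and] at hw
        exact mul_le_mul (hgood _ _ (hw.1.2 hw.1.1))
          (hgood _ _ fun h => hw.2 hw.1.1 (hbadsymm _ _ h)) hNK' (hr₂0 _))
    refine le_trans ?_ h1
    calc N ^ 7 / (2 ^ 19 * K ^ 9)
        = N / (8 * K) * ((N ^ 3 / (256 * K ^ 4)) * (N ^ 3 / (256 * K ^ 4))) := by
          rw [div_mul_div_comm, div_mul_div_comm]; congr 1 <;> ring
      _ ≤ _ := by gcongr
  refine ⟨A', hA'sub.trans hΓA, ?_, ?_⟩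
  · nlinarith
  · have h1 : (#(A' - A') : ℝ) * (N ^ 7 / (2 ^ 19 * K ^ 9)) ≤ N ^ 8 := by
      calc (#(A' - A') : ℝ) * (N ^ 7 / (2 ^ 19 * K ^ 9))
          ≤ ∑ d ∈ A' - A', conv r₂ r₂ d := by
            rw [← nsmul_eq_mul, ← sum_const]
            refine sum_le_sum fun d hd => ?_
            obtain ⟨a, ha, b, hb, rfl⟩ := mem_sub.1 hd
            exact hpop a ha b hb
        _ ≤ ∑ d, conv r₂ r₂ d :=
            sum_le_sum_of_subset_of_nonneg (subset_univ _) fun d _ _ =>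
              hconv_nonneg _ _ hr₂0 hr₂0 d
        _ = N ^ 8 := by
            rw [hconv_sum, hconv_sum, hrsum]; ring
    rw [mul_div_assoc', div_le_iff₀ (by positivity)] at h1
    have h2 : N ^ 7 * (#(A' - A') : ℝ) ≤ N ^ 7 * (2 ^ 19 * K ^ 9 * N) := by
      calc _ = (#(A' - A') : ℝ) * N ^ 7 := by ring
        _ ≤ _ := h1
        _ = _ := by ring
    exact le_of_mul_le_mul_left h2 (by positivity)

theorem exists_subset_add_sub_self {G : Type*} [AddCommGroup G] [DecidableEq G] (X D : Finset G)
    {L : ℝ} (hne : (X ∩ D).Nonempty) (h : (#(X - X) : ℝ) ≤ L * #(X ∩ D)) :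
    ∃ F : Finset G, (#F : ℝ) ≤ L ∧ X ⊆ F + (D - D) := by
  obtain ⟨F, -, hF, hcov⟩ := ruzsa_covering_add (A := X) (B := -(X ∩ D)) (K := L) hne.neg (by
    rw [card_neg, ← sub_eq_add_neg]
    refine le_trans ?_ h
    exact_mod_cast card_le_card (sub_subset_sub_left inter_subset_left))
  refine ⟨F, hF, hcov.trans (add_subset_add_left ?_)⟩
  intro x hx
  obtain ⟨u, hu, v, hv, rfl⟩ := mem_sub.1 hx
  rw [mem_neg'] at hu hv
  exact mem_sub.2 ⟨-v, (mem_inter.1 hv).2, -u, (mem_inter.1 hu).2, by abel⟩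

theorem card_nsmul_sub_nsmul_le {G : Type*} [AddCommGroup G] [DecidableEq G] {D : Finset G}
    (hD : D.Nonempty) {K : ℝ} (h : (#(D - D) : ℝ) ≤ K * #D) (m n : ℕ) :
    (#(m • D - n • D) : ℝ) ≤ K ^ (m + n) * #D := by
  have h1 := pluennecke_ruzsa_inequality_nsmul_sub_nsmul_sub hD D m n
  have h2 : (#(m • D - n • D) : ℝ) ≤ (#(D - D) / #D : ℝ) ^ (m + n) * #D := by
    have := (NNRat.cast_le (K := ℝ)).2 h1
    rw [NNRat.cast_natCast] at this
    refine this.trans (le_of_eq ?_)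
    push_cast
    rfl
  have hpos : (0 : ℝ) < #D := by exact_mod_cast hD.card_pos
  refine h2.trans ?_
  gcongr
  rwa [div_le_iff₀ hpos]

/-- If the dilates `a • A`, `b • A`, `c • A`, `d • A` are covered by few translates of `D - D`,
then `(c - d) • A + (c - d + a - b) • A` is small. -/
theorem card_image_dilates_le {R : Type*} [CommRing R] [DecidableEq R] (A D : Finset R)
    {L M : ℝ} (hM : (#(6 • D - 6 • D) : ℝ) ≤ M) {a b c d : R}
    (hcov : ∀ e ∈ ({a, b, c, d} : Set R),
      ∃ F : Finset R, (#F : ℝ) ≤ L ∧ A.image (e * ·) ⊆ F + (D - D)) :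
    (#((A ×ˢ A).image fun t => (c - d) * t.1 + (c - d + (a - b)) * t.2) : ℝ) ≤ L ^ 6 * M := by
  obtain ⟨Fa, hFa, ha⟩ := hcov a (by simp)
  obtain ⟨Fb, hFb, hb⟩ := hcov b (by simp)
  obtain ⟨Fc, hFc, hc⟩ := hcov c (by simp)
  obtain ⟨Fd, hFd, hd⟩ := hcov d (by simp)
  have hsub : ((A ×ˢ A).image fun t => (c - d) * t.1 + (c - d + (a - b)) * t.2) ⊆
      ((Fc - Fd) + ((Fc - Fd) + (Fa - Fb))) + (6 • D - 6 • D) := by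
    intro z hz
    obtain ⟨⟨x, y⟩, hxy, rfl⟩ := mem_image.1 hz
    obtain ⟨hx, hy⟩ := mem_product.1 hxy
    have key : ∀ {e : R} {F : Finset R}, A.image (e * ·) ⊆ F + (D - D) → ∀ x ∈ A,
        ∃ f ∈ F, ∃ u ∈ D, ∃ v ∈ D, f + (u - v) = e * x := by
      intro e F h x hx
      obtain ⟨f, hf, w, hw, h1⟩ := mem_add.1 (h (mem_image_of_mem _ hx))
      obtain ⟨u, hu, v, hv, rfl⟩ := mem_sub.1 hw
      exact ⟨f, hf, u, hu, v, hv, h1⟩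
    obtain ⟨f₁, hf₁, u₁, hu₁, v₁, hv₁, e₁⟩ := key hc x hx
    obtain ⟨f₂, hf₂, u₂, hu₂, v₂, hv₂, e₂⟩ := key hd x hx
    obtain ⟨f₃, hf₃, u₃, hu₃, v₃, hv₃, e₃⟩ := key hc y hy
    obtain ⟨f₄, hf₄, u₄, hu₄, v₄, hv₄, e₄⟩ := key hd y hy
    obtain ⟨f₅, hf₅, u₅, hu₅, v₅, hv₅, e₅⟩ := key ha y hy
    obtain ⟨f₆, hf₆, u₆, hu₆, v₆, hv₆, e₆⟩ := key hb y hy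
    have six : ∀ {x₁ x₂ x₃ x₄ x₅ x₆ : R}, x₁ ∈ D → x₂ ∈ D → x₃ ∈ D → x₄ ∈ D → x₅ ∈ D → x₆ ∈ D →
        x₁ + x₂ + x₃ + x₄ + x₅ + x₆ ∈ 6 • D := by
      intro x₁ x₂ x₃ x₄ x₅ x₆ h₁ h₂ h₃ h₄ h₅ h₆
      have : 6 • D = D + D + D + D + D + D := by
        simp only [succ_nsmul, zero_nsmul, zero_add]
      rw [this]
      exact add_mem_add (add_mem_add (add_mem_add (add_mem_add (add_mem_add h₁ h₂) h₃) h₄) h₅) h₆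
    refine mem_add.2 ⟨(f₁ - f₂) + ((f₃ - f₄) + (f₅ - f₆)),
      add_mem_add (sub_mem_sub hf₁ hf₂) (add_mem_add (sub_mem_sub hf₃ hf₄) (sub_mem_sub hf₅ hf₆)),
      (u₁ + v₂ + u₃ + v₄ + u₅ + v₆) - (v₁ + u₂ + v₃ + u₄ + v₅ + u₆),
      sub_mem_sub (six hu₁ hv₂ hu₃ hv₄ hu₅ hv₆) (six hv₁ hu₂ hv₃ hu₄ hv₅ hu₆), ?_⟩
    linear_combination e₁ - e₂ + e₃ - e₄ + e₅ - e₆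
  have hcard : #((A ×ˢ A).image fun t => (c - d) * t.1 + (c - d + (a - b)) * t.2) ≤
      ((#Fc * #Fd) * ((#Fc * #Fd) * (#Fa * #Fb))) * #(6 • D - 6 • D) := by
    have h1 : #(Fc - Fd) ≤ #Fc * #Fd := card_sub_le
    have h2 : #(Fa - Fb) ≤ #Fa * #Fb := card_sub_le
    have h3 : #((Fc - Fd) + (Fa - Fb)) ≤ #(Fc - Fd) * #(Fa - Fb) := card_add_le
    have h4 : #((Fc - Fd) + ((Fc - Fd) + (Fa - Fb))) ≤ #(Fc - Fd) * #((Fc - Fd) + (Fa - Fb)) :=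
      card_add_le
    refine (card_le_card hsub).trans (card_add_le.trans (Nat.mul_le_mul_right _ ?_))
    exact h4.trans (Nat.mul_le_mul h1 (h3.trans (Nat.mul_le_mul h1 h2)))
  generalize #((A ×ˢ A).image fun t => (c - d) * t.1 + (c - d + (a - b)) * t.2) = n at hcard ⊢
  generalize #(6 • D - 6 • D) = m at hcard hM
  have hL : 0 ≤ L := (Nat.cast_nonneg _).trans hFa
  calc (n : ℝ) ≤ ((#Fc * #Fd) * ((#Fc * #Fd) * (#Fa * #Fb))) * m := by exact_mod_cast hcard
    _ ≤ ((L * L) * ((L * L) * (L * L))) * M := by gcongr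
    _ = L ^ 6 * M := by ring

/-- If all the dilated sumsets `A + ξ • A` are small, then `A` is either bounded or dense. -/
theorem card_le_or_le_of_forall_card_image_le {p : ℕ} [Fact p.Prime] (A : Finset (ZMod p)) {M : ℝ}
    (hA : A.Nonempty)
    (h : ∀ ξ : ZMod p, (#((A ×ˢ A).image fun t => t.1 + ξ * t.2) : ℝ) ≤ M) :
    (#A : ℝ) ^ 2 ≤ 2 * M ∨ (p : ℝ) ≤ 2 * M := by
  have hN : (0 : ℝ) < #A := by exact_mod_cast hA.card_pos
  have hp : (0 : ℝ) < p := by exact_mod_cast (Fact.out : p.Prime).pos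
  let E : ZMod p → Finset ((ZMod p × ZMod p) × (ZMod p × ZMod p)) := fun ξ =>
    {t ∈ (A ×ˢ A) ×ˢ (A ×ˢ A) | t.1.1 + ξ * t.1.2 = t.2.1 + ξ * t.2.2}
  have hlow : ∀ ξ, (#A : ℝ) ^ 4 ≤ M * #(E ξ) := by
    intro ξ
    let φ : ZMod p × ZMod p → ZMod p := fun t => t.1 + ξ * t.2
    have h1 : #(A ×ˢ A) = ∑ z ∈ (A ×ˢ A).image φ, #{t ∈ A ×ˢ A | φ t = z} :=
      card_eq_sum_card_image φ _
    have h2 : #(E ξ) = ∑ z ∈ (A ×ˢ A).image φ, #{t ∈ A ×ˢ A | φ t = z} ^ 2 := by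
      rw [card_eq_sum_card_fiberwise (f := fun t => φ t.1) (s := E ξ) (t := (A ×ˢ A).image φ) (by
        intro t ht
        simp only [E, coe_filter, mem_product, Set.mem_ofPred_eq] at ht
        exact mem_image_of_mem _ (mem_product.2 ht.1.1))]
      refine sum_congr rfl fun z _ => ?_
      rw [sq, ← card_product]
      congr 1
      ext ⟨s, t⟩
      simp only [E, φ, mem_filter, mem_product]
      constructor
      · rintro ⟨⟨⟨h1, h2⟩, h3⟩, h4⟩
        exact ⟨⟨h1, h4⟩, h2, h3 ▸ h4⟩
      · rintro ⟨⟨h1, h2⟩, h3, h4⟩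
        exact ⟨⟨⟨h1, h3⟩, h2.trans h4.symm⟩, h2⟩
    have h3 := sq_sum_le_card_mul_sum_sq (s := (A ×ˢ A).image φ)
      (f := fun z => #{t ∈ A ×ˢ A | φ t = z})
    rw [← h1, ← h2, card_product] at h3
    have h4 : (#A : ℝ) ^ 4 ≤ #((A ×ˢ A).image φ) * #(E ξ) := by
      calc (#A : ℝ) ^ 4 = (#A * #A) ^ 2 := by ring
        _ ≤ _ := by exact_mod_cast h3
    exact h4.trans (mul_le_mul_of_nonneg_right (h ξ) (Nat.cast_nonneg _))
  have hup : ∑ ξ, #(E ξ) ≤ p * #A ^ 2 + #A ^ 4 := by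
    have h1 : ∑ ξ, #(E ξ) = ∑ t ∈ (A ×ˢ A) ×ˢ (A ×ˢ A),
        #{ξ : ZMod p | t.1.1 + ξ * t.1.2 = t.2.1 + ξ * t.2.2} :=
      sum_card_bipartiteAbove_eq_sum_card_bipartiteBelow _
    have h2 : ∀ t ∈ (A ×ˢ A) ×ˢ (A ×ˢ A),
        #{ξ : ZMod p | t.1.1 + ξ * t.1.2 = t.2.1 + ξ * t.2.2} ≤ (if t.1 = t.2 then p else 0) + 1 := by
      rintro ⟨⟨x, y⟩, ⟨x', y'⟩⟩ -
      split_ifs with heq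
      · exact (card_le_univ _).trans (by rw [ZMod.card]; omega)
      · rw [zero_add, card_le_one]
        intro ξ hξ ζ hζ
        simp only [mem_filter, mem_univ, true_and] at hξ hζ heq
        by_contra hne
        have hy : y = y' := by
          have : (ξ - ζ) * (y - y') = 0 := by linear_combination hξ - hζ
          rcases mul_eq_zero.1 this with h | h
          · exact absurd (sub_eq_zero.1 h) hne
          · exact sub_eq_zero.1 h
        subst hy
        exact heq (by rw [add_right_cancel hξ])
    rw [h1]
    refine (sum_le_sum h2).trans (le_of_eq ?_)
    rw [sum_add_distrib, sum_const, smul_eq_mul, mul_one, card_product, card_product,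
      sum_product]
    simp only [sum_ite_eq]
    rw [sum_congr rfl (fun x hx => if_pos hx), sum_const, card_product, smul_eq_mul]
    ring
  have hup' : ∑ ξ, (#(E ξ) : ℝ) ≤ p * (#A : ℝ) ^ 2 + (#A : ℝ) ^ 4 := by exact_mod_cast hup
  have hM : 0 ≤ M := (Nat.cast_nonneg _).trans (h 0)
  have hmain : p * (#A : ℝ) ^ 4 ≤ M * (p * (#A : ℝ) ^ 2 + (#A : ℝ) ^ 4) := by
    calc (p : ℝ) * (#A : ℝ) ^ 4 = ∑ _ξ : ZMod p, (#A : ℝ) ^ 4 := by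
          rw [sum_const, card_univ, ZMod.card, nsmul_eq_mul]
      _ ≤ ∑ ξ, M * #(E ξ) := sum_le_sum fun ξ _ => hlow ξ
      _ = M * ∑ ξ, (#(E ξ) : ℝ) := by rw [mul_sum]
      _ ≤ _ := by gcongr
  have hN2 : 0 < (#A : ℝ) ^ 2 := by positivity
  rcases le_total (p : ℝ) ((#A : ℝ) ^ 2) with hle | hle
  · right
    have : (#A : ℝ) ^ 4 * p ≤ (#A : ℝ) ^ 4 * (2 * M) := by
      have : M * (p * (#A : ℝ) ^ 2) ≤ M * ((#A : ℝ) ^ 2 * (#A : ℝ) ^ 2) := by gcongr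
      nlinarith
    exact le_of_mul_le_mul_left this (by positivity)
  · left
    have : (p * (#A : ℝ) ^ 2) * (#A : ℝ) ^ 2 ≤ (p * (#A : ℝ) ^ 2) * (2 * M) := by
      have : M * ((#A : ℝ) ^ 2 * (#A : ℝ) ^ 2) ≤ M * (p * (#A : ℝ) ^ 2) := by gcongr
      nlinarith
    exact le_of_mul_le_mul_left this (by positivity)

/-- The solutions of `a * b = c * d` in `A`. -/
def prodQuads {R : Type*} [DecidableEq R] [Mul R] (A : Finset R) : Finset (R × R × R × R) :=
  {t ∈ A ×ˢ A ×ˢ A ×ˢ A | t.1 * t.2.1 = t.2.2.1 * t.2.2.2}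

/-- If `A` has many multiplicative quadruples, then many dilates of `A` correlate with one fixed
dilate. -/
theorem exists_popular_dilate {F : Type*} [Field F] [DecidableEq F] (A : Finset F)
    (hA : A.Nonempty) (h0 : (0 : F) ∉ A) {K : ℝ} (hK : 0 < K)
    (hE : (#A : ℝ) ^ 3 ≤ K * #(prodQuads A)) :
    ∃ b ∈ A, (#A : ℝ) ≤ 2 * K *
      #{a ∈ A | (#A : ℝ) ≤ 2 * K * #(A.image (a * ·) ∩ A.image (b * ·))} := by
  have hN : (0 : ℝ) < #A := by exact_mod_cast hA.card_pos
  let I : F → F → Finset F := fun b a => A.image (a * ·) ∩ A.image (b * ·)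
  have hcount : #(prodQuads A) ≤ ∑ b ∈ A, ∑ a ∈ A, #(I b a) := by
    rw [← sum_product' A A fun b a => #(I b a),
      card_eq_sum_card_fiberwise (f := fun t : F × F × F × F => (t.2.2.1, t.1))
        (s := prodQuads A) (t := A ×ˢ A) (by
          intro t ht
          simp only [prodQuads, coe_filter, mem_product, Set.mem_ofPred_eq] at ht
          simp [ht.1.1, ht.1.2.2.1])]
    refine sum_le_sum fun s _ => card_le_card_of_injOn (fun t => t.1 * t.2.1) ?_ ?_
    · rintro ⟨a, b, c, d⟩ ht
      simp only [prodQuads, coe_filter, mem_filter, mem_product, Set.mem_ofPred_eq] at ht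
      obtain ⟨⟨⟨ha, hb, hc, hd⟩, h⟩, rfl⟩ := ht
      simp only [I, coe_inter, coe_image, Set.mem_inter_iff]
      exact ⟨⟨b, hb, rfl⟩, ⟨d, hd, h.symm⟩⟩
    · rintro ⟨a, b, c, d⟩ ht ⟨a', b', c', d'⟩ ht' heq
      simp only [prodQuads, coe_filter, mem_filter, mem_product, Set.mem_ofPred_eq] at ht ht' heq
      obtain ⟨⟨⟨ha, hb, hc, hd⟩, h⟩, rfl⟩ := ht
      obtain ⟨⟨-, h'⟩, h2⟩ := ht'
      simp only [Prod.mk.injEq] at h2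
      obtain ⟨rfl, rfl⟩ := h2
      have ha0 : a' ≠ 0 := fun h => h0 (h ▸ ha)
      have hc0 : c' ≠ 0 := fun h => h0 (h ▸ hc)
      obtain rfl := mul_left_cancel₀ ha0 heq
      obtain rfl := mul_left_cancel₀ hc0 (h.symm.trans h')
      rfl
  have hcount' : (#(prodQuads A) : ℝ) ≤ ∑ b ∈ A, ∑ a ∈ A, (#(I b a) : ℝ) := by
    exact_mod_cast hcount
  obtain ⟨b, hb, hsum⟩ : ∃ b ∈ A, (#A : ℝ) ^ 2 ≤ K * ∑ a ∈ A, (#(I b a) : ℝ) := by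
    apply exists_le_of_sum_le hA
    rw [sum_const, nsmul_eq_mul, ← mul_sum]
    calc (#A : ℝ) * #A ^ 2 = #A ^ 3 := by ring
      _ ≤ _ := hE
      _ ≤ _ := by gcongr
  refine ⟨b, hb, ?_⟩
  set A₁ : Finset F := {a ∈ A | (#A : ℝ) ≤ 2 * K * #(A.image (a * ·) ∩ A.image (b * ·))} with hA₁
  have hI : ∀ a ∈ A, (2 * K * #(I b a) : ℝ) ≤
      (if (#A : ℝ) ≤ 2 * K * #(A.image (a * ·) ∩ A.image (b * ·)) then 2 * K * #A else 0) + #A := by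
    intro a _
    split_ifs with h
    · have : (#(I b a) : ℝ) ≤ #A :=
        Nat.cast_le.2 ((card_le_card inter_subset_left).trans card_image_le)
      have : 2 * K * (#(I b a) : ℝ) ≤ 2 * K * #A := by gcongr
      linarith
    · rw [zero_add]
      exact (not_le.1 h).le
  have h1 := sum_le_sum hI
  rw [sum_add_distrib, ← sum_filter, sum_const, sum_const, nsmul_eq_mul, nsmul_eq_mul,
    ← mul_sum, ← hA₁] at h1
  have h2 : (#A : ℝ) * #A ≤ #A * (2 * K * #A₁) := by nlinarith
  exact le_of_mul_le_mul_left h2 hN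

/-- A **sum-product theorem**: a subset of `ZMod p` with small difference set and large
multiplicative energy is either bounded or dense. -/
theorem card_le_or_le_of_small_sub_of_large_energy {p : ℕ} [Fact p.Prime] (A : Finset (ZMod p))
    (hA : A.Nonempty) (h0 : (0 : ZMod p) ∉ A) {K : ℝ} (hK : 1 ≤ K)
    (hsub : (#(A - A) : ℝ) ≤ K * #A) (hE : (#A : ℝ) ^ 3 ≤ K * #(prodQuads A)) :
    (#A : ℝ) ≤ 256 * K ^ 26 ∨ (p : ℝ) ≤ 128 * K ^ 24 * #A := by
  have hN : (0 : ℝ) < #A := by exact_mod_cast hA.card_pos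
  obtain ⟨b₀, hb₀, hpop⟩ := exists_popular_dilate A hA h0 (by linarith) hE
  set A₁ : Finset (ZMod p) :=
    {a ∈ A | (#A : ℝ) ≤ 2 * K * #(A.image (a * ·) ∩ A.image (b₀ * ·))} with hA₁
  have hA₁A : A₁ ⊆ A := filter_subset _ _
  set D := A.image (b₀ * ·) with hD
  have hDA : #D = #A := card_image_of_injective _
    (mul_right_injective₀ fun h => h0 (h ▸ hb₀))
  have hdil : ∀ a, (#(A.image (a * ·) - A.image (a * ·)) : ℝ) ≤ K * #A := by
    intro a
    refine le_trans (Nat.cast_le.2 ?_) hsub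
    refine (card_le_card (t := (A - A).image (a * ·)) fun z hz => ?_).trans card_image_le
    obtain ⟨x, hx, y, hy, rfl⟩ := mem_sub.1 hz
    obtain ⟨x', hx', rfl⟩ := mem_image.1 hx
    obtain ⟨y', hy', rfl⟩ := mem_image.1 hy
    exact mem_image.2 ⟨x' - y', sub_mem_sub hx' hy', by ring⟩
  have h6 : (#(6 • D - 6 • D) : ℝ) ≤ K ^ 12 * #A := by
    have := card_nsmul_sub_nsmul_le (hA.image (b₀ * ·)) (K := K) (by
      rw [← hD, hDA]; exact hdil b₀) 6 6
    rwa [← hD, hDA] at this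
  have hcov : ∀ e ∈ A₁, ∃ F : Finset (ZMod p), (#F : ℝ) ≤ 2 * K ^ 2 ∧
      A.image (e * ·) ⊆ F + (D - D) := by
    intro e he
    rw [hA₁, mem_filter] at he
    refine exists_subset_add_sub_self _ _ ?_ ?_
    · rw [← card_pos]
      by_contra! h
      rw [Nat.le_zero.1 h] at he
      simp only [Nat.cast_zero, mul_zero] at he
      linarith [he.2]
    · calc _ ≤ K * (#A : ℝ) := hdil e
        _ ≤ K * (2 * K * #(A.image (e * ·) ∩ D)) := by gcongr; exact he.2
        _ = _ := by ring
  set M : ℝ := (2 * K ^ 2) ^ 6 * (K ^ 12 * #A) with hM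
  have hsmall : ∀ a ∈ A₁, ∀ b ∈ A₁, ∀ c ∈ A₁, ∀ d ∈ A₁, c ≠ d →
      (#((A ×ˢ A).image fun t => t.1 + (1 + (a - b) / (c - d)) * t.2) : ℝ) ≤ M := by
    intro a ha b hb c hc d hd hcd
    have hcd' : c - d ≠ 0 := sub_ne_zero.2 hcd
    refine le_trans (le_of_eq ?_) (card_image_dilates_le A D h6 (L := 2 * K ^ 2)
      (a := a) (b := b) (c := c) (d := d) (by
        intro e he
        simp only [Set.mem_insert_iff, Set.mem_singleton_iff] at he
        rcases he with rfl | rfl | rfl | rfl <;> exact hcov _ ‹_›))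
    rw [← card_image_of_injective _ (mul_right_injective₀ hcd'), image_image]
    congr 3
    funext t
    simp only [Function.comp]
    field_simp
  by_cases hone : #A₁ ≤ 1
  · left
    have h1 : (#A₁ : ℝ) ≤ 1 := by exact_mod_cast hone
    have h2 : 2 * K * (#A₁ : ℝ) ≤ 2 * K * 1 := by gcongr
    have h3 : K ≤ K ^ 26 := le_self_pow₀ hK (by norm_num)
    linarith
  obtain ⟨u, hu, v, hv, huv⟩ := one_lt_card.1 (not_le.1 hone)
  let R : ZMod p → Prop := fun ξ =>
    ∃ a ∈ A₁, ∃ b ∈ A₁, ∃ c ∈ A₁, ∃ d ∈ A₁, c ≠ d ∧ ξ = (a - b) / (c - d)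
  by_cases hR : ∀ ξ, R (ξ - 1) → R ξ
  · have hall : ∀ ξ, R ξ := by
      have h1 : ∀ n : ℕ, R (n : ZMod p) := by
        intro n
        induction n with
        | zero => exact ⟨u, hu, u, hu, u, hu, v, hv, huv, by simp⟩
        | succ n ih => exact hR _ (by simpa using ih)
      intro ξ
      rw [← ZMod.natCast_zmod_val ξ]
      exact h1 _
    have himg : ∀ ξ : ZMod p, (#((A ×ˢ A).image fun t => t.1 + ξ * t.2) : ℝ) ≤ M := by
      intro ξ
      obtain ⟨a, ha, b, hb, c, hc, d, hd, hcd, h⟩ := hall (ξ - 1)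
      have := hsmall a ha b hb c hc d hd hcd
      rwa [← h, add_sub_cancel] at this
    rcases card_le_or_le_of_forall_card_image_le A hA himg with h | h
    · left
      have h1 : (#A : ℝ) * #A ≤ #A * (128 * K ^ 24) := by rw [hM] at h; linarith
      have h2 := le_of_mul_le_mul_left h1 hN
      have h3 : K ^ 24 ≤ K ^ 26 := pow_le_pow_right₀ hK (by norm_num)
      have h4 : 0 ≤ K ^ 24 := by positivity
      linarith
    · right
      rw [hM] at h
      linarith
  · left
    push Not at hR
    obtain ⟨ξ, ⟨a, ha, b, hb, c, hc, d, hd, hcd, h⟩, hξ⟩ := hR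
    have h1 := hsmall a ha b hb c hc d hd hcd
    rw [← h, add_sub_cancel] at h1
    have hinj : Set.InjOn (fun t : ZMod p × ZMod p => t.1 + ξ * t.2) (A₁ ×ˢ A₁ : Finset _) := by
      rintro ⟨x, y⟩ hxy ⟨x', y'⟩ hxy' heq
      simp only [coe_product, Set.mem_prod, mem_coe] at hxy hxy' heq
      by_cases hy : y = y'
      · subst hy
        rw [add_right_cancel heq]
      · refine absurd ⟨x, hxy.1, x', hxy'.1, y', hxy'.2, y, hxy.2, Ne.symm hy, ?_⟩ hξ
        rw [eq_div_iff (sub_ne_zero.2 (Ne.symm hy))]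
        linear_combination -heq
    have h2 : (#A₁ : ℝ) ^ 2 ≤ M := by
      refine le_trans ?_ h1
      rw [sq, ← Nat.cast_mul, ← card_product, ← card_image_of_injOn hinj]
      exact Nat.cast_le.2 (card_le_card (image_subset_image (product_subset_product hA₁A hA₁A)))
    have h3 : (#A : ℝ) ^ 2 ≤ (2 * K * #A₁) ^ 2 := by gcongr
    have h4 : (#A : ℝ) * #A ≤ #A * (256 * K ^ 26) := by
      calc (#A : ℝ) * #A = #A ^ 2 := by ring
        _ ≤ _ := h3
        _ = 4 * K ^ 2 * (#A₁ : ℝ) ^ 2 := by ring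
        _ ≤ 4 * K ^ 2 * M := by gcongr
        _ = _ := by rw [hM]; ring
    exact le_of_mul_le_mul_left h4 hN

/-- Half of any set of nonzero residues modulo `p` admits a Freiman isomorphism from its
multiplicative structure to an additive group of large prime order. -/
theorem exists_log_model {p : ℕ} [Fact p.Prime] (A : Finset (ZMod p)) (h0 : (0 : ZMod p) ∉ A) :
    ∃ A₀ ⊆ A, #A ≤ 2 * #A₀ ∧ ∃ q : ℕ, q.Prime ∧ q ≠ 2 ∧ ∃ g : ZMod p → ZMod q,
      ∀ a ∈ A₀, ∀ b ∈ A₀, ∀ c ∈ A₀, ∀ d ∈ A₀, a * b = c * d ↔ g a + g b = g c + g d := by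
  classical
  have hp := (Fact.out : p.Prime).two_le
  let e := (zmodCyclicMulEquiv (inferInstance : IsCyclic (ZMod p)ˣ)).symm
  set n := Nat.card (ZMod p)ˣ with hn
  have hnp : n < p := by
    rw [hn, Nat.card_eq_fintype_card, ZMod.card_units]
    omega
  have hn0 : 0 < n := Nat.card_pos
  have : NeZero n := ⟨hn0.ne'⟩
  let l : ZMod p → ZMod n := fun x => if h : x ≠ 0 then (e (Units.mk0 x h)).toAdd else 0
  have hne : ∀ x ∈ A, x ≠ 0 := fun x hx h => h0 (h ▸ hx)
  have hl : ∀ a ∈ A, ∀ b ∈ A, ∀ c ∈ A, ∀ d ∈ A, a * b = c * d ↔ l a + l b = l c + l d := by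
    intro a ha b hb c hc d hd
    simp only [l, dif_pos (hne a ha), dif_pos (hne b hb), dif_pos (hne c hc), dif_pos (hne d hd)]
    rw [← toAdd_mul, ← toAdd_mul, ← map_mul, ← map_mul, Multiplicative.toAdd.apply_eq_iff_eq,
      e.apply_eq_iff_eq, Units.ext_iff]
    rfl
  obtain ⟨q, hq, hqp⟩ := Nat.exists_infinite_primes (2 * p)
  let A₁ : Finset (ZMod p) := {x ∈ A | 2 * (l x).val < n}
  let A₂ : Finset (ZMod p) := {x ∈ A | ¬ 2 * (l x).val < n}
  have hcard : #A₁ + #A₂ = #A := card_filter_add_card_filter_not _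
  obtain ⟨A₀, hA₀, hbig, P, hP⟩ : ∃ A₀ ⊆ A, #A ≤ 2 * #A₀ ∧ ∃ P : Prop, ∀ x ∈ A₀,
      (2 * (l x).val < n ↔ P) := by
    rcases le_total #A₁ #A₂ with h | h
    · exact ⟨A₂, filter_subset _ _, by omega, False, fun x hx => by
        simpa only [iff_false] using (mem_filter.1 hx).2⟩
    · exact ⟨A₁, filter_subset _ _, by omega, True, fun x hx => by
        simpa only [iff_true] using (mem_filter.1 hx).2⟩
  refine ⟨A₀, hA₀, hbig, q, hqp, by omega, fun x => ((l x).val : ZMod q), ?_⟩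
  intro a ha b hb c hc d hd
  rw [hl a (hA₀ ha) b (hA₀ hb) c (hA₀ hc) d (hA₀ hd), ← Nat.cast_add, ← Nat.cast_add,
    ZMod.natCast_eq_natCast_iff']
  have la := ZMod.val_lt (l a)
  have lb := ZMod.val_lt (l b)
  have lc := ZMod.val_lt (l c)
  have ld := ZMod.val_lt (l d)
  rw [Nat.mod_eq_of_lt (by omega), Nat.mod_eq_of_lt (by omega)]
  constructor
  · intro h
    exact val_add_val_eq_of_add_eq h ((hP a ha).trans (hP c hc).symm)
      ((hP a ha).trans (hP d hd).symm) ((hP a ha).trans (hP b hb).symm)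
  · intro h
    have := congrArg (Nat.cast : ℕ → ZMod n) h
    simpa using this

theorem exists_sidonVia_of_mul_card_sumQuads_le {α : Type*} {q q' : ℕ}
    [Fact q.Prime] [Fact q'.Prime] (hq' : q' ≠ 2) (B : Finset α) (hB : B.Nonempty)
    (f : α → ZMod q) (g : α → ZMod q') (hf : Set.InjOn f B) (hg : Set.InjOn g B)
    {K : ℝ} (hK : 1 ≤ K) (hKB : K ^ 2 ≤ #B) (hE : K * #(sumQuads B g) ≤ (#B : ℝ) ^ 3) :
    ∃ S ⊆ B, SidonVia S f ∧ SidonVia S g ∧ #B * K ≤ 2 ^ 37 * (#S : ℝ) ^ 3 := by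
  have hn : (0 : ℝ) < #B := by exact_mod_cast hB.card_pos
  have hK0 : 0 < K := zero_lt_one.trans_le hK
  generalize hnB : (#B : ℝ) = n at *
  have hn1 : 1 ≤ n := by
    rw [← hnB]
    exact_mod_cast hB.card_pos
  obtain ⟨ρ, hρ0, hρ⟩ : ∃ ρ : ℝ, 0 ≤ ρ ∧ K * ρ ^ 3 = n ^ 2 := by
    refine ⟨(n ^ 2 / K) ^ ((1 : ℝ) / 3), by positivity, ?_⟩
    rw [← Real.rpow_natCast, ← Real.rpow_mul (by positivity)]
    norm_num
    field_simp
  have hρn : n ≤ ρ ^ 2 := by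
    have h1 : n ^ 3 ≤ (ρ ^ 2) ^ 3 := by
      have h2 : K ^ 2 * n ^ 3 ≤ K ^ 2 * (ρ ^ 2) ^ 3 := by
        calc K ^ 2 * n ^ 3 ≤ n * n ^ 3 := by gcongr
          _ = (K * ρ ^ 3) ^ 2 := by rw [hρ]; ring
          _ = _ := by ring
      exact le_of_mul_le_mul_left h2 (by positivity)
    exact le_of_pow_le_pow_left₀ (by norm_num) (by positivity) h1
  have hρ1 : 1 ≤ ρ := by
    by_contra! h
    nlinarith
  obtain ⟨r, hr, hmr, hr2⟩ := Nat.exists_prime_lt_and_le_two_mul ⌈16 * ρ⌉₊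
    (Nat.ceil_pos.2 (by positivity)).ne'
  have : Fact r.Prime := ⟨hr⟩
  have hrlow : 16 * ρ ≤ r := (Nat.le_ceil _).trans (by exact_mod_cast hmr.le)
  have hrup : (r : ℝ) ≤ 34 * ρ := by
    have h1 := (Nat.ceil_lt_add_one (show 0 ≤ 16 * ρ by positivity)).le
    have h2 : (r : ℝ) ≤ 2 * ⌈16 * ρ⌉₊ := by exact_mod_cast hr2
    linarith
  obtain ⟨S, hS, hSf, hSg, hcard⟩ := exists_sidonVia_of_card_sumQuads_le (r := r) hq'
    (by
      have : (2 : ℝ) < r := by linarith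
      exact_mod_cast this) B f g hf hg
    (by
      have : 256 * (#B : ℝ) ≤ (r : ℝ) ^ 2 := by
        calc 256 * (#B : ℝ) ≤ (16 * ρ) ^ 2 := by rw [hnB]; linarith
          _ ≤ _ := by gcongr
      exact_mod_cast this)
    (by
      have : 256 * (#(sumQuads B g) : ℝ) ≤ #B * (r : ℝ) ^ 3 := by
        have h1 : K * (256 * (#(sumQuads B g) : ℝ)) ≤ K * (#B * (r : ℝ) ^ 3) := by
          calc K * (256 * (#(sumQuads B g) : ℝ)) ≤ 256 * n ^ 3 := by linarith
            _ = 256 * (n * (K * ρ ^ 3)) := by rw [hρ]; ring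
            _ ≤ 4096 * (n * (K * ρ ^ 3)) := by gcongr; norm_num
            _ = K * (n * (16 * ρ) ^ 3) := by ring
            _ ≤ K * (#B * (r : ℝ) ^ 3) := by rw [hnB]; gcongr
        exact le_of_mul_le_mul_left h1 hK0
      exact_mod_cast this)
  refine ⟨S, hS, hSf, hSg, ?_⟩
  have h1 : n ≤ 128 * (#S * r) := by
    rw [← hnB]
    exact_mod_cast hcard
  have h2 : n ≤ 4352 * (#S * ρ) := by
    have : (#S : ℝ) * r ≤ #S * (34 * ρ) := by gcongr
    linarith
  have h3 : n ^ 2 * (n * K) ≤ n ^ 2 * (2 ^ 37 * (#S : ℝ) ^ 3) := by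
    calc n ^ 2 * (n * K) = n ^ 3 * K := by ring
      _ ≤ (4352 * (#S * ρ)) ^ 3 * K := by gcongr
      _ = 4352 ^ 3 * ((#S : ℝ) ^ 3 * (K * ρ ^ 3)) := by ring
      _ ≤ 2 ^ 37 * ((#S : ℝ) ^ 3 * (K * ρ ^ 3)) := by gcongr; norm_num
      _ = _ := by rw [hρ]; ring
  exact le_of_mul_le_mul_left h3 (by positivity)

theorem exists_biSidon_subset {p : ℕ} [Fact p.Prime] {q : ℕ} [Fact q.Prime] (hq : q ≠ 2)
    (A : Finset (ZMod p)) (h0 : (0 : ZMod p) ∉ A) (g : ZMod p → ZMod q)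
    (hg : ∀ a ∈ A, ∀ b ∈ A, ∀ c ∈ A, ∀ d ∈ A, a * b = c * d ↔ g a + g b = g c + g d)
    {K : ℝ} (hK : 1 ≤ K) (hbig : 2 ^ 583 * K ^ 261 < #A) (hsparse : 2 ^ 535 * K ^ 240 * #A < p) :
    ∃ S ⊆ A, IsBiSidon (S : Set (ZMod p)) ∧ #A * K ≤ 2 ^ 37 * (#S : ℝ) ^ 3 := by
  have hK0 : 0 < K := zero_lt_one.trans_le hK
  have hN : (0 : ℝ) < #A := lt_trans (by positivity) hbig
  have hA : A.Nonempty := card_pos.1 (by exact_mod_cast hN)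
  have hp2 : p ≠ 2 := by
    rintro rfl
    have h1 : #A ≤ 2 := (card_le_univ A).trans (by rw [ZMod.card])
    have h2 : (#A : ℝ) ≤ 2 := by exact_mod_cast h1
    have h3 : 1 ≤ K ^ 261 := one_le_pow₀ hK
    linarith
  have hginj : Set.InjOn g A := by
    intro x hx y hy hxy
    have h1 := (hg x hx x hx y hy x hx).2 (by rw [hxy])
    exact mul_right_cancel₀ (fun h => h0 (h ▸ hx)) h1
  have hbi : ∀ S ⊆ A, SidonVia S (id : ZMod p → ZMod p) → SidonVia S g →
      IsBiSidon (S : Set (ZMod p)) := by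
    intro S hS h1 h2
    constructor
    · intro a ha b hb c hc d hd h
      rcases h1 a ha b hb c hc d hd h with ⟨rfl, rfl⟩ | ⟨rfl, rfl⟩
      · rfl
      · exact Set.pair_comm _ _
    · intro a ha b hb c hc d hd h
      rcases h2 a ha b hb c hc d hd ((hg a (hS ha) b (hS hb) c (hS hc) d (hS hd)).1 h) with
        ⟨rfl, rfl⟩ | ⟨rfl, rfl⟩
      · rfl
      · exact Set.pair_comm _ _
  have hKA : K ^ 2 ≤ #A := by
    have h1 : K ^ 2 ≤ K ^ 261 := pow_le_pow_right₀ hK (by norm_num)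
    have h2 : 1 ≤ K ^ 261 := one_le_pow₀ hK
    linarith
  by_cases hE : K * #(sumQuads A (id : ZMod p → ZMod p)) ≤ (#A : ℝ) ^ 3
  · obtain ⟨S, hS, h1, h2, h3⟩ := exists_sidonVia_of_mul_card_sumQuads_le hp2 A hA g id hginj
      (Function.injective_id.injOn) hK hKA hE
    exact ⟨S, hS, hbi S hS h2 h1, h3⟩
  obtain ⟨B, hBA, hB, hBB⟩ := balog_szemeredi_gowers A hA hK (not_le.1 hE).le
  have hm : (0 : ℝ) < #B := by
    by_contra! h
    have : 8 * K * (#B : ℝ) ≤ 0 := mul_nonpos_of_nonneg_of_nonpos (by positivity) h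
    linarith
  have hBne : B.Nonempty := card_pos.1 (by exact_mod_cast hm)
  have hB0 : (0 : ZMod p) ∉ B := fun h => h0 (hBA h)
  obtain ⟨L, hL⟩ : ∃ L, L = 2 ^ 22 * K ^ 10 := ⟨_, rfl⟩
  have hL1 : 1 ≤ L := by
    have : 1 ≤ K ^ 10 := one_le_pow₀ hK
    linarith
  have hLB : 256 * L ^ 26 < #B := by
    have h1 : 8 * K * (256 * L ^ 26) < 8 * K * #B := by
      calc 8 * K * (256 * L ^ 26) = 2 ^ 583 * K ^ 261 := by rw [hL]; ring
        _ < (#A : ℝ) := hbig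
        _ ≤ 8 * K * #B := hB
    exact lt_of_mul_lt_mul_left h1 (by positivity)
  have hEB : L * #(sumQuads B g) ≤ (#B : ℝ) ^ 3 := by
    have hquads : sumQuads B g = prodQuads B := by
      refine filter_congr fun t ht => ?_
      simp only [mem_product] at ht
      exact (hg _ (hBA ht.1) _ (hBA ht.2.1) _ (hBA ht.2.2.1) _ (hBA ht.2.2.2)).symm
    rw [hquads]
    by_contra! h
    rcases card_le_or_le_of_small_sub_of_large_energy B hBne hB0 hL1 (by
      calc (#(B - B) : ℝ) ≤ 2 ^ 19 * K ^ 9 * #A := hBB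
        _ ≤ 2 ^ 19 * K ^ 9 * (8 * K * #B) := by gcongr
        _ = L * #B := by rw [hL]; ring) h.le with h1 | h1
    · linarith
    · have h2 : (#B : ℝ) ≤ #A := Nat.cast_le.2 (card_le_card hBA)
      have h3 : 128 * L ^ 24 * #B ≤ 2 ^ 535 * K ^ 240 * #A := by
        calc 128 * L ^ 24 * (#B : ℝ) ≤ 128 * L ^ 24 * #A := by gcongr
          _ = _ := by rw [hL]; ring
      linarith
  have hLB2 : L ^ 2 ≤ #B := by
    have h1 : L ^ 2 ≤ L ^ 26 := pow_le_pow_right₀ hL1 (by norm_num)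
    have h2 : 1 ≤ L ^ 26 := one_le_pow₀ hL1
    linarith
  obtain ⟨S, hS, h1, h2, h3⟩ := exists_sidonVia_of_mul_card_sumQuads_le hq B hBne id g
    (Function.injective_id.injOn) (hginj.mono (by exact_mod_cast hBA)) hL1 hLB2 hEB
  refine ⟨S, hS.trans hBA, hbi S (hS.trans hBA) h1 h2, le_trans ?_ h3⟩
  have h4 : 8 * K ^ 2 ≤ L := by
    have : K ^ 2 ≤ K ^ 10 := pow_le_pow_right₀ hK (by norm_num)
    have : 1 ≤ K ^ 10 := one_le_pow₀ hK
    linarith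
  calc (#A : ℝ) * K ≤ 8 * K * #B * K := by gcongr
    _ = #B * (8 * K ^ 2) := by ring
    _ ≤ #B * L := by gcongr

end Helpers

theorem bi_sidon_Fp_general :
    ∀ ε > (0 : ℝ), ∃ δ > (0 : ℝ), ∃ c > (0 : ℝ), ∀ p : ℕ, p.Prime →
      ∀ A : Finset (ZMod p), (A.card : ℝ) ≤ (p : ℝ) ^ ((1 : ℝ) - ε) →
      ∃ S ⊆ A, IsBiSidon (S : Set (ZMod p)) ∧
        c * (A.card : ℝ) ^ ((1 : ℝ) / 3 + δ) ≤ S.card := by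
  intro ε₀ hε₀
  obtain ⟨ε, hε, hεε₀, hε1⟩ : ∃ ε : ℝ, 0 < ε ∧ ε ≤ ε₀ ∧ ε ≤ 1 / 2 :=
    ⟨min ε₀ (1 / 2), by positivity, min_le_left _ _, min_le_right _ _⟩
  set η := ε / 1000 with hη
  have hη0 : 0 < η := by positivity
  set N₀ : ℝ := ((2 : ℝ) ^ 585) ^ (2 / ε) with hN₀
  have hN₀0 : 0 < N₀ := by positivity
  refine ⟨η / 3, by positivity, min (1 / 2 ^ 13) (1 / N₀ ^ ((1 : ℝ) / 3 + η / 3)),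
    by positivity, ?_⟩
  intro p hp A hA
  have : Fact p.Prime := ⟨hp⟩
  have hp1 : (1 : ℝ) ≤ p := by exact_mod_cast hp.one_lt.le
  rcases A.eq_empty_or_nonempty with rfl | hne
  · refine ⟨∅, subset_rfl, ⟨by simp [IsAddSidon], by simp [IsMulSidon]⟩, ?_⟩
    rw [Finset.card_empty, Nat.cast_zero, Real.zero_rpow (by positivity), mul_zero]
  have hN1 : (1 : ℝ) ≤ A.card := by exact_mod_cast hne.card_pos
  have hN0 : (0 : ℝ) < A.card := by linarith
  by_cases hsmall : (A.card : ℝ) ≤ N₀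
  · obtain ⟨a, ha⟩ := hne
    refine ⟨{a}, Finset.singleton_subset_iff.2 ha,
      ⟨by simp [IsAddSidon], by simp [IsMulSidon]⟩, ?_⟩
    rw [Finset.card_singleton, Nat.cast_one]
    calc _ ≤ 1 / N₀ ^ ((1 : ℝ) / 3 + η / 3) * N₀ ^ ((1 : ℝ) / 3 + η / 3) := by
          gcongr
          exact min_le_right _ _
      _ = 1 := by field_simp
  rw [not_le] at hsmall
  have hbig : (2 : ℝ) ^ 585 < (A.card : ℝ) ^ (ε / 2) := by
    calc (2 : ℝ) ^ 585 = N₀ ^ (ε / 2) := by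
          rw [hN₀, ← Real.rpow_mul (by positivity), div_mul_div_comm, mul_comm 2 ε,
            div_self (by positivity), Real.rpow_one]
      _ < _ := Real.rpow_lt_rpow hN₀0.le hsmall (by positivity)
  have hpN : (A.card : ℝ) ^ (1 + ε) ≤ p := by
    calc (A.card : ℝ) ^ (1 + ε) ≤ ((p : ℝ) ^ (1 - ε)) ^ (1 + ε) := by
          gcongr
          exact hA.trans (Real.rpow_le_rpow_of_exponent_le hp1 (by linarith))
      _ = (p : ℝ) ^ ((1 - ε) * (1 + ε)) := by rw [← Real.rpow_mul (by positivity)]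
      _ ≤ (p : ℝ) ^ (1 : ℝ) := Real.rpow_le_rpow_of_exponent_le hp1 (by nlinarith)
      _ = p := Real.rpow_one _
  obtain ⟨A₀, hA₀, hcard, q, hq, hq2, g, hg⟩ := exists_log_model (A.erase 0) (by simp)
  have : Fact q.Prime := ⟨hq⟩
  have hA₀A : A₀ ⊆ A := hA₀.trans (Finset.erase_subset _ _)
  have hle : (A₀.card : ℝ) ≤ A.card := Nat.cast_le.2 (Finset.card_le_card hA₀A)
  have hNN : (A.card : ℝ) ^ (ε / 2) ≤ A.card := by
    calc (A.card : ℝ) ^ (ε / 2) ≤ (A.card : ℝ) ^ (1 : ℝ) :=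
          Real.rpow_le_rpow_of_exponent_le hN1 (by linarith)
      _ = _ := Real.rpow_one _
  have hge : (A.card : ℝ) ≤ 4 * A₀.card := by
    have h1 := Finset.pred_card_le_card_erase (s := A) (a := 0)
    have h2 : A.card ≤ 2 * A₀.card + 1 := by omega
    have h3 : (A.card : ℝ) ≤ 2 * A₀.card + 1 := by exact_mod_cast h2
    linarith
  have hK : 1 ≤ (A.card : ℝ) ^ η := Real.one_le_rpow hN1 hη0.le
  have hKpow : ∀ k : ℕ, ((A.card : ℝ) ^ η) ^ k = (A.card : ℝ) ^ (η * k) := by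
    intro k
    rw [Real.rpow_mul hN0.le, Real.rpow_natCast]
  obtain ⟨S, hS, hbi, hSK⟩ := exists_biSidon_subset hq2 A₀ (fun h => by simpa using hA₀ h) g hg hK
    (by
      rw [hKpow]
      have h1 : (2 : ℝ) ^ 585 * (A.card : ℝ) ^ (η * (261 : ℕ)) < A.card := by
        calc (2 : ℝ) ^ 585 * (A.card : ℝ) ^ (η * (261 : ℕ))
            < (A.card : ℝ) ^ (ε / 2) * (A.card : ℝ) ^ (η * (261 : ℕ)) := by gcongr
          _ = (A.card : ℝ) ^ (ε / 2 + η * (261 : ℕ)) := by rw [Real.rpow_add hN0]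
          _ ≤ (A.card : ℝ) ^ (1 : ℝ) := by
              refine Real.rpow_le_rpow_of_exponent_le hN1 ?_
              push_cast
              linarith
          _ = _ := Real.rpow_one _
      linarith)
    (by
      rw [hKpow]
      calc (2 : ℝ) ^ 535 * (A.card : ℝ) ^ (η * (240 : ℕ)) * A₀.card
          ≤ (2 : ℝ) ^ 585 * (A.card : ℝ) ^ (η * (240 : ℕ)) * A.card := by gcongr <;> norm_num
        _ < (A.card : ℝ) ^ (ε / 2) * (A.card : ℝ) ^ (η * (240 : ℕ)) * A.card := by gcongr
        _ = (A.card : ℝ) ^ (ε / 2 + η * (240 : ℕ) + 1) := by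
            rw [Real.rpow_add hN0, Real.rpow_add hN0, Real.rpow_one]
        _ ≤ (A.card : ℝ) ^ (1 + ε) := by
            refine Real.rpow_le_rpow_of_exponent_le hN1 ?_
            push_cast
            linarith
        _ ≤ p := hpN)
  refine ⟨S, hS.trans hA₀A, hbi, ?_⟩
  have hfin : (A.card : ℝ) * (A.card : ℝ) ^ η ≤ (2 ^ 13 * (S.card : ℝ)) ^ 3 := by
    have : (A.card : ℝ) * (A.card : ℝ) ^ η ≤ 4 * A₀.card * (A.card : ℝ) ^ η := by gcongr
    linarith
  have hcube : ((A.card : ℝ) ^ ((1 : ℝ) / 3 + η / 3)) ^ 3 = (A.card : ℝ) * (A.card : ℝ) ^ η := by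
    rw [← Real.rpow_natCast, ← Real.rpow_mul hN0.le, show ((1 : ℝ) / 3 + η / 3) * (3 : ℕ) = 1 + η by
      push_cast; ring, Real.rpow_add hN0, Real.rpow_one]
  rw [← hcube] at hfin
  have hroot := le_of_pow_le_pow_left₀ (by norm_num) (by positivity) hfin
  calc _ ≤ 1 / 2 ^ 13 * (A.card : ℝ) ^ ((1 : ℝ) / 3 + η / 3) := by
        gcongr
        exact min_le_left _ _
    _ ≤ 1 / 2 ^ 13 * (2 ^ 13 * S.card) := by gcongr
    _ = S.card := by ring
end

section
/- Let A ⊆ ℤ be a finite set of size N, let p be a prime, and let d ≥ 1 be an integer satisfying N ≤ 2^{−2d−1} · p^d. Then there exists a subset A' ⊆ A of size at least 2^{−d−1} · N and a map f : A' → (ℤ/pℤ)^d that is injective on A' and satisfies: for all a, b, a', b' ∈ A', if a + b = a' + b' then f(a) + f(b) = f(a') + f(b'). -/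
open Finset

/-- For every dilation `c` modulo a prime `q`, at least half of the residues are mapped into the
lower half of `[0, q)`. -/
lemma le_two_mul_card_dilate_lt_half {q : ℕ} (hq : q.Prime) (c : ℤ) :
    q ≤ 2 * #{t ∈ range q | 2 * ((c * ((t : ℕ) : ℤ)) % q) < q} := by
  have hq0 : (0 : ℤ) < q := by exact_mod_cast hq.pos
  by_cases hc : (q : ℤ) ∣ c
  · have : {t ∈ range q | 2 * ((c * ((t : ℕ) : ℤ)) % q) < q} = range q := by
      refine filter_true_of_mem fun t _ => ?_
      rw [Int.emod_eq_zero_of_dvd (hc.mul_right _)]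
      simpa using hq.pos
    rw [this, card_range]
    omega
  · obtain ⟨u, v, huv⟩ : IsCoprime c (q : ℤ) :=
      ((Nat.prime_iff_prime_int.mp hq).coprime_iff_not_dvd.mpr hc).symm
    have key : ∀ r : ℕ, r < q → (c * (((u * r) % q).toNat : ℤ)) % q = r := by
      intro r hr
      rw [Int.toNat_of_nonneg (Int.emod_nonneg _ hq0.ne'), Int.mul_emod, Int.emod_emod,
        ← Int.mul_emod, show c * (u * r) = r + q * (-(v * r)) by linear_combination (r : ℤ) * huv,
        Int.add_mul_emod_self_left]
      exact Int.emod_eq_of_lt (by positivity) (by exact_mod_cast hr)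
    have hcard : #(range ((q + 1) / 2)) ≤
        #{t ∈ range q | 2 * ((c * ((t : ℕ) : ℤ)) % q) < q} := by
      refine card_le_card_of_injOn (fun r : ℕ => ((u * r) % q).toNat) ?_ ?_
      · intro r hr
        have hr' : r < (q + 1) / 2 := by simpa using hr
        have h1 := Int.emod_lt_of_pos (u * r) hq0
        have h2 := Int.emod_nonneg (u * r) hq0.ne'
        simp only [coe_filter, Set.mem_ofPred_eq, mem_range]
        refine ⟨by omega, ?_⟩
        rw [key r (by omega)]
        omega
      · intro r hr s hs hrs
        have hr' : r < (q + 1) / 2 := by simpa using hr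
        have hs' : s < (q + 1) / 2 := by simpa using hs
        have h1 := key r (by omega)
        have h2 := key s (by omega)
        simp only at hrs
        rw [hrs, h2] at h1
        exact_mod_cast h1.symm
    rw [card_range] at hcard
    omega

open Classical in
/-- For a nonzero `c` modulo a prime `q`, few multiples of `c` are within `q / (2 * p)` of a
multiple of `q`. -/
lemma mul_card_dilate_near_zero_le {p q : ℕ} (hp : 0 < p) (hq : q.Prime) {c : ℤ}
    (hc : ¬ (q : ℤ) ∣ c) :
    p * #{t ∈ range q | ∃ k s : ℤ, c * ((t : ℕ) : ℤ) = q * k + s ∧ 2 * p * |s| < q} ≤ q + p := by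
  set T := {t ∈ range q | ∃ k s : ℤ, c * ((t : ℕ) : ℤ) = q * k + s ∧ 2 * p * |s| < q}
  have hex : ∀ t ∈ T, ∃ s k : ℤ, c * (t : ℤ) = q * k + s ∧ 2 * p * |s| < q := by
    intro t ht
    obtain ⟨k, s, h⟩ := (mem_filter.mp ht).2
    exact ⟨s, k, h⟩
  choose! s k hs hlt using hex
  have hcard : #T ≤ #(Icc (-((q / (2 * p) : ℕ) : ℤ)) ((q / (2 * p) : ℕ) : ℤ)) := by
    refine card_le_card_of_injOn s ?_ ?_
    · intro t ht
      have h := hlt t ht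
      have : (s t).natAbs ≤ q / (2 * p) := by
        rw [Nat.le_div_iff_mul_le (by omega)]
        have h' : 2 * p * (s t).natAbs < q := by
          rw [← Int.natCast_natAbs] at h
          exact_mod_cast h
        nlinarith
      simp only [coe_Icc, Set.mem_Icc]
      omega
    · intro t ht t' ht' h
      have h1 : (q : ℤ) ∣ c * ((t : ℤ) - t') :=
        ⟨k t - k t', by linear_combination hs t ht - hs t' ht' + h⟩
      have h2 := ((Nat.prime_iff_prime_int.mp hq).dvd_or_dvd h1).resolve_left hc
      have ht1 : t < q := mem_range.mp (mem_filter.mp ht).1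
      have ht2 : t' < q := mem_range.mp (mem_filter.mp ht').1
      have h3 := Int.eq_zero_of_abs_lt_dvd h2 (abs_lt.mpr ⟨by omega, by omega⟩)
      omega
  rw [Int.card_Icc] at hcard
  have h1 : #T ≤ 2 * (q / (2 * p)) + 1 := by omega
  have h2 := Nat.div_mul_le_self q (2 * p)
  nlinarith

/-- The number of vectors all of whose entries satisfy `P`. -/
lemma card_filter_piFinset_const {d : ℕ} (s : Finset ℕ) (P : ℕ → Prop) [DecidablePred P] :
    #{l ∈ Fintype.piFinset fun _ : Fin d => s | ∀ i, P (l i)} = #{t ∈ s | P t} ^ d := by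
  have : {l ∈ Fintype.piFinset fun _ : Fin d => s | ∀ i, P (l i)} =
      Fintype.piFinset fun _ : Fin d => {t ∈ s | P t} := by
    ext l
    simp [Fintype.mem_piFinset, forall_and]
  rw [this, Fintype.card_piFinset_const]

/-- A set with few collisions contains a large subset without collisions. -/
lemma exists_subset_injOn_card_le {α β : Type*} [DecidableEq α] (S : Finset α) (f : α → β)
    (B : Finset (α × α)) (hB : ∀ a ∈ S, ∀ b ∈ S, a ≠ b → f a = f b → (a, b) ∈ B) :
    ∃ S' ⊆ S, #S ≤ #S' + #B ∧ Set.InjOn f (S' : Set α) := by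
  classical
  refine ⟨{a ∈ S | ∀ b ∈ S, f a = f b → a = b}, filter_subset _ _, ?_, ?_⟩
  · have hsub : {a ∈ S | ¬ ∀ b ∈ S, f a = f b → a = b} ⊆ B.image Prod.fst := by
      intro a ha
      obtain ⟨haS, ha⟩ := mem_filter.mp ha
      push Not at ha
      obtain ⟨b, hb, hab, hne⟩ := ha
      exact mem_image.mpr ⟨(a, b), hB a haS b hb hne hab, rfl⟩
    have h1 := (card_le_card hsub).trans card_image_le
    have h2 := card_filter_add_card_filter_not (s := S) (fun a => ∀ b ∈ S, f a = f b → a = b)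
    omega
  · intro a ha b hb hab
    exact (mem_filter.mp ha).2 b (mem_filter.mp hb).1 hab

/-- Integers with remainders in the lower half of `[0, q)` have additive quotients. -/
lemma ediv_add_ediv_eq_of_emod_lt_half {q x y x' y' : ℤ} (hq : 0 < q) (hx : 2 * (x % q) < q)
    (hy : 2 * (y % q) < q) (hx' : 2 * (x' % q) < q) (hy' : 2 * (y' % q) < q)
    (h : x + y = x' + y') : x / q + y / q = x' / q + y' / q := by
  have aux : ∀ u v : ℤ, 2 * (u % q) < q → 2 * (v % q) < q → (u + v) / q = u / q + v / q := by
    intro u v hu hv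
    have h1 := Int.emod_nonneg u hq.ne'
    have h2 := Int.emod_nonneg v hq.ne'
    have h3 : u + v = (u % q + v % q) + q * (u / q + v / q) := by
      linear_combination -(Int.emod_add_mul_ediv u q) - Int.emod_add_mul_ediv v q
    rw [h3, Int.add_mul_ediv_left _ _ hq.ne', Int.ediv_eq_zero_of_lt (by omega) (by omega),
      zero_add]
  rw [← aux x y hx hy, ← aux x' y' hx' hy', h]

/-- If two multiples of `p` have remainders in the lower half of `[0, q)` and quotients congruent
modulo `p`, then the difference of the cofactors is near a multiple of `q`. -/
lemma exists_near_of_ediv_modEq {p q : ℕ} (hp : 0 < p) (hq : 0 < q) {x y : ℤ}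
    (hx : 2 * ((p * x) % q) < q) (hy : 2 * ((p * y) % q) < q)
    (h : (((p * x) / q : ℤ) : ZMod p) = ((p * y) / q : ℤ)) :
    ∃ k s : ℤ, x - y = q * k + s ∧ 2 * p * |s| < q := by
  have hq' : (q : ℤ) ≠ 0 := by exact_mod_cast hq.ne'
  have hp' : (0 : ℤ) < p := by exact_mod_cast hp
  obtain ⟨k, hk⟩ := (ZMod.intCast_eq_intCast_iff_dvd_sub _ _ _).mp h.symm
  have hs : (p : ℤ) * (x - y - q * k) = (p * x) % q - (p * y) % q := by
    linear_combination
      -(Int.emod_add_mul_ediv (p * x) q) + Int.emod_add_mul_ediv (p * y) q + (q : ℤ) * hk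
  refine ⟨k, x - y - q * k, by ring, ?_⟩
  have h1 := Int.emod_nonneg (p * x) hq'
  have h2 := Int.emod_nonneg (p * y) hq'
  have habs : (p : ℤ) * |x - y - q * k| = |(p * x) % q - (p * y) % q| := by
    rw [← hs, abs_mul, abs_of_pos hp']
  rw [mul_assoc, habs]
  have := abs_lt.mpr (show -(q : ℤ) < 2 * ((p * x) % q - (p * y) % q) ∧
    2 * ((p * x) % q - (p * y) % q) < q by omega)
  rwa [abs_mul, abs_two] at this

lemma add_pow_le_two_mul_pow {d : ℕ} {p q : ℝ} (hp : 0 < p) (hq : 2 * d * p ≤ q) (hq0 : 0 < q) :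
    (q + p) ^ d ≤ 2 * q ^ d := by
  have hpq : 0 < q + p := by positivity
  have h1 : p / (q + p) ≤ 1 := (div_le_one hpq).mpr (by linarith)
  have h2 := one_add_mul_le_pow (a := -(p / (q + p))) (by linarith) d
  have h3 : (d : ℝ) * (p / (q + p)) ≤ 1 / 2 := by
    rw [← mul_div_assoc, div_le_iff₀ hpq]
    linarith
  have h4 : 1 + -(p / (q + p)) = q / (q + p) := by
    field_simp
    ring
  rw [h4, div_pow] at h2
  have h5 : 1 / 2 ≤ q ^ d / (q + p) ^ d := by linarith
  rw [le_div_iff₀ (by positivity)] at h5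
  linarith

theorem freiman_embedding_into_Fp_pow
    (A : Finset ℤ) (p d : ℕ) (hp : p.Prime) (hd : 1 ≤ d)
    (hN : (A.card : ℝ) ≤ (2 : ℝ) ^ (-(2 * (d : ℝ)) - 1) * (p : ℝ) ^ (d : ℕ)) :
    ∃ A' ⊆ A, (2 : ℝ) ^ (-(d : ℝ) - 1) * (A.card : ℝ) ≤ A'.card ∧
      ∃ f : ℤ → (Fin d → ZMod p), Set.InjOn f (A' : Set ℤ) ∧
        ∀ a ∈ A', ∀ b ∈ A', ∀ a' ∈ A', ∀ b' ∈ A',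
          a + b = a' + b' → f a + f b = f a' + f b' := by
  classical
  have hp0 : (0 : ℝ) < p := by exact_mod_cast hp.pos
  obtain ⟨q, hqle, hq⟩ :=
    Nat.exists_infinite_primes (2 * d * p + 2 * (∑ a ∈ A, a.natAbs) + 1)
  have hqpos : (0 : ℝ) < q := by exact_mod_cast hq.pos
  have hqZ : (0 : ℤ) < q := by exact_mod_cast hq.pos
  have hndvd : ∀ a ∈ A, ∀ b ∈ A, a ≠ b → ¬ (q : ℤ) ∣ a - b := by
    intro a ha b hb hab hdvd
    have h1 := single_le_sum (f := Int.natAbs) (fun _ _ => Nat.zero_le _) ha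
    have h2 := single_le_sum (f := Int.natAbs) (fun _ _ => Nat.zero_le _) hb
    have h3 := Int.eq_zero_of_abs_lt_dvd hdvd (abs_lt.mpr ⟨by omega, by omega⟩)
    omega
  let L := Fintype.piFinset fun _ : Fin d => range q
  let S : (Fin d → ℕ) → Finset ℤ := fun l => {a ∈ A | ∀ i, 2 * ((p * a * (l i : ℤ)) % q) < q}
  let B : (Fin d → ℕ) → Finset (ℤ × ℤ) := fun l =>
    {x ∈ A.offDiag | ∀ i, ∃ k s : ℤ, (x.1 - x.2) * (l i : ℤ) = q * k + s ∧ 2 * p * |s| < q}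
  have hL : (#L : ℝ) = (q : ℝ) ^ d := by simp [L]
  have hS : (#A : ℝ) * ((q : ℝ) / 2) ^ d ≤ ∑ l ∈ L, (#(S l) : ℝ) := by
    have hswap : ∑ l ∈ L, #(S l) =
        ∑ a ∈ A, #{l ∈ L | ∀ i, 2 * ((p * a * (l i : ℤ)) % q) < q} :=
      sum_card_bipartiteAbove_eq_sum_card_bipartiteBelow _
    rw [← Nat.cast_sum, hswap, Nat.cast_sum, ← nsmul_eq_mul]
    refine card_nsmul_le_sum _ _ _ fun a _ => ?_
    rw [card_filter_piFinset_const (range q) fun t : ℕ => 2 * ((p * a * (t : ℤ)) % q) < q]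
    push_cast
    gcongr
    have := le_two_mul_card_dilate_lt_half hq (p * a)
    rw [div_le_iff₀ two_pos, mul_comm]
    exact_mod_cast this
  have hB : ∑ l ∈ L, (#(B l) : ℝ) ≤ (#A : ℝ) ^ 2 * (((q : ℝ) + p) / p) ^ d := by
    have hswap : ∑ l ∈ L, #(B l) = ∑ x ∈ A.offDiag, #{l ∈ L | ∀ i, ∃ k s : ℤ,
        (x.1 - x.2) * (l i : ℤ) = q * k + s ∧ 2 * p * |s| < q} :=
      sum_card_bipartiteAbove_eq_sum_card_bipartiteBelow _
    have hoff : (#A.offDiag : ℝ) ≤ (#A : ℝ) ^ 2 := by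
      rw [offDiag_card, sq]
      exact_mod_cast Nat.sub_le _ _
    rw [← Nat.cast_sum, hswap, Nat.cast_sum]
    refine (sum_le_card_nsmul _ _ ((((q : ℝ) + p) / p) ^ d) fun x hx => ?_).trans ?_
    · obtain ⟨ha, hb, hab⟩ := mem_offDiag.mp hx
      rw [card_filter_piFinset_const (range q) fun t : ℕ => ∃ k s : ℤ,
        (x.1 - x.2) * (t : ℤ) = q * k + s ∧ 2 * p * |s| < q]
      push_cast
      gcongr
      have := mul_card_dilate_near_zero_le hp.pos hq (hndvd _ ha _ hb hab)
      rw [le_div_iff₀ hp0, mul_comm]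
      exact_mod_cast this
    · rw [nsmul_eq_mul]
      gcongr
  have h2d : (2 : ℝ) ^ (-(2 * (d : ℝ)) - 1) = 1 / (2 * (2 ^ d) ^ 2) := by
    rw [Real.rpow_sub_one two_ne_zero, Real.rpow_neg two_pos.le, mul_comm, Real.rpow_mul two_pos.le,
      Real.rpow_natCast, Real.rpow_two]
    field_simp
  have h1d : (2 : ℝ) ^ (-(d : ℝ) - 1) = 1 / (2 * 2 ^ d) := by
    rw [Real.rpow_sub_one two_ne_zero, Real.rpow_neg two_pos.le, Real.rpow_natCast]
    field_simp
  have h2le : (2 : ℝ) ≤ 2 ^ d := le_self_pow₀ one_le_two (by omega)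
  have hpow : ((q : ℝ) + p) ^ d ≤ 2 * (q : ℝ) ^ d := by
    refine add_pow_le_two_mul_pow hp0 ?_ hqpos
    exact_mod_cast (show 2 * d * p ≤ q by omega)
  have hB' : (#A : ℝ) ^ 2 * (((q : ℝ) + p) / p) ^ d ≤
      (#A : ℝ) * ((q : ℝ) ^ d / (2 ^ d) ^ 2) := by
    rw [h2d, one_div_mul_eq_div, le_div_iff₀ (by positivity)] at hN
    rw [sq, mul_assoc, div_pow]
    gcongr
    rw [← mul_div_assoc, div_le_div_iff₀ (by positivity) (by positivity)]
    calc (#A : ℝ) * (q + p) ^ d * (2 ^ d) ^ 2 ≤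
          (#A : ℝ) * (2 * (q : ℝ) ^ d) * (2 ^ d) ^ 2 := by gcongr
      _ = (q : ℝ) ^ d * ((#A : ℝ) * (2 * (2 ^ d) ^ 2)) := by ring
      _ ≤ (q : ℝ) ^ d * (p : ℝ) ^ d := by gcongr
  obtain ⟨l, -, hl⟩ : ∃ l ∈ L, 1 / (2 * 2 ^ d) * (#A : ℝ) + #(B l) ≤ #(S l) := by
    refine exists_le_of_sum_le ?_ ?_
    · exact Fintype.piFinset_nonempty.mpr fun _ => ⟨0, mem_range.mpr hq.pos⟩
    · rw [sum_add_distrib, sum_const, nsmul_eq_mul, hL]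
      refine (add_le_add_right (hB.trans hB') _).trans (le_trans ?_ hS)
      have : (1 : ℝ) / (2 * 2 ^ d) + 1 / (2 ^ d) ^ 2 ≤ 1 / 2 ^ d := by
        rw [div_add_div _ _ (by positivity) (by positivity),
          div_le_div_iff₀ (by positivity) (by positivity)]
        nlinarith [mul_nonneg (sq_nonneg ((2 : ℝ) ^ d)) (sub_nonneg.mpr h2le)]
      calc (q : ℝ) ^ d * (1 / (2 * 2 ^ d) * (#A : ℝ)) + (#A : ℝ) * ((q : ℝ) ^ d / (2 ^ d) ^ 2)
          = (#A : ℝ) * (q : ℝ) ^ d * (1 / (2 * 2 ^ d) + 1 / (2 ^ d) ^ 2) := by ring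
        _ ≤ (#A : ℝ) * (q : ℝ) ^ d * (1 / 2 ^ d) := by gcongr
        _ = (#A : ℝ) * ((q : ℝ) / 2) ^ d := by rw [div_pow]; ring
  let f : ℤ → Fin d → ZMod p := fun a i => ((p * a * (l i : ℤ) / q : ℤ) : ZMod p)
  obtain ⟨A', hA'S, hcard, hinj⟩ := exists_subset_injOn_card_le (S l) f (B l) (by
    intro a ha b hb hab hf
    obtain ⟨haA, ha⟩ := mem_filter.mp ha
    obtain ⟨hbA, hb⟩ := mem_filter.mp hb
    refine mem_filter.mpr ⟨mem_offDiag.mpr ⟨haA, hbA, hab⟩, fun i => ?_⟩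
    have hai := ha i
    have hbi := hb i
    have hfi : ((p * a * (l i : ℤ) / q : ℤ) : ZMod p) = (p * b * (l i : ℤ) / q : ℤ) :=
      congrFun hf i
    rw [mul_assoc] at hai hbi
    rw [mul_assoc, mul_assoc (p : ℤ) b] at hfi
    rw [sub_mul]
    exact exists_near_of_ediv_modEq hp.pos hq.pos hai hbi hfi)
  refine ⟨A', hA'S.trans (filter_subset _ _), ?_, f, hinj, ?_⟩
  · rw [h1d]
    have : (#(S l) : ℝ) ≤ #A' + #(B l) := by exact_mod_cast hcard
    linarith
  · intro a ha b hb a' ha' b' hb' h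
    have hmem : ∀ x ∈ A', ∀ i, 2 * ((p * x * (l i : ℤ)) % q) < q := fun x hx =>
      (mem_filter.mp (hA'S hx)).2
    funext i
    have := ediv_add_ediv_eq_of_emod_lt_half hqZ (hmem a ha i) (hmem b hb i) (hmem a' ha' i)
      (hmem b' hb' i) (by linear_combination (p : ℤ) * (l i : ℤ) * h)
    simp only [Pi.add_apply, f]
    exact_mod_cast congrArg (Int.cast : ℤ → ZMod p) this
end

section
/- Let p be an odd prime and let v₁, v₂, v₃ ∈ 𝔽_p² be three pairwise distinct vectors. Then p³ · #{g : 𝔽_p² → 𝔽_p² invertible affine map with {v₁, v₂, v₃} ⊆ g(P₀)} ≤ #{all invertible affine maps g : 𝔽_p² → 𝔽_p²}. Equivalently, if P = g(P₀) for a uniformly random invertible affine map g, then Pr[{v₁, v₂, v₃} ⊆ P] ≤ p^{−3}. -/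
/-- The standard parabola `{(t, t²) : t ∈ 𝔽_p}` in `𝔽_p²`. -/
def stdParabola (p : ℕ) : Set (Fin 2 → ZMod p) :=
  {v | ∃ t : ZMod p, v = ![t, t ^ 2]}

/-- The image of a set under the invertible affine map `x ↦ Mx + w` given by
a pair `g = (M, w)` with `M ∈ GL₂(𝔽_p)` and `w ∈ 𝔽_p²`. -/
def affImage {p : ℕ} (g : (Matrix (Fin 2) (Fin 2) (ZMod p))ˣ × (Fin 2 → ZMod p))
    (S : Set (Fin 2 → ZMod p)) : Set (Fin 2 → ZMod p) :=
  (fun x => (g.1 : Matrix (Fin 2) (Fin 2) (ZMod p)).mulVec x + g.2) '' S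

/-- A quadratic polynomial vanishing at three distinct points is zero. -/
theorem quadratic_coeffs_eq_zero_s6 {F : Type*} [Field F] {a b c r s t : F}
    (hrs : r ≠ s) (hrt : r ≠ t) (hst : s ≠ t)
    (hr : a * r + b * r ^ 2 + c = 0) (hs : a * s + b * s ^ 2 + c = 0)
    (ht : a * t + b * t ^ 2 + c = 0) : a = 0 ∧ b = 0 ∧ c = 0 := by
  have h1 : a + b * (r + s) = 0 :=
    mul_left_cancel₀ (sub_ne_zero.2 hrs) (by linear_combination hr - hs)
  have h2 : a + b * (r + t) = 0 :=
    mul_left_cancel₀ (sub_ne_zero.2 hrt) (by linear_combination hr - ht)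
  have hb : b = 0 := mul_left_cancel₀ (sub_ne_zero.2 hst) (by linear_combination h1 - h2)
  subst hb
  have ha : a = 0 := by linear_combination h1
  subst ha
  exact ⟨rfl, rfl, by linear_combination hr⟩

/-- An invertible affine map is determined by its values at three distinct points of the
parabola. -/
theorem affine_eq_of_eqOn_parabola {p : ℕ} [Fact p.Prime]
    {g h : (Matrix (Fin 2) (Fin 2) (ZMod p))ˣ × (Fin 2 → ZMod p)} {t : Fin 3 → ZMod p}
    (ht : Function.Injective t)
    (hgh : ∀ i, (g.1 : Matrix (Fin 2) (Fin 2) (ZMod p)).mulVec ![t i, t i ^ 2] + g.2 =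
      (h.1 : Matrix (Fin 2) (Fin 2) (ZMod p)).mulVec ![t i, t i ^ 2] + h.2) : g = h := by
  have hzero (j : Fin 2) (i : Fin 3) :
      (g.1.1 j 0 - h.1.1 j 0) * t i + (g.1.1 j 1 - h.1.1 j 1) * t i ^ 2 +
        (g.2 j - h.2 j) = 0 := by
    have := congrFun (hgh i) j
    simp only [Pi.add_apply, Matrix.mulVec, dotProduct, Fin.sum_univ_two, Matrix.cons_val_zero,
      Matrix.cons_val_one] at this
    linear_combination this
  have hcoeff (j : Fin 2) := quadratic_coeffs_eq_zero_s6 (ht.ne (show (0 : Fin 3) ≠ 1 by decide))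
    (ht.ne (show (0 : Fin 3) ≠ 2 by decide)) (ht.ne (show (1 : Fin 3) ≠ 2 by decide))
    (hzero j 0) (hzero j 1) (hzero j 2)
  refine Prod.ext (Units.ext (Matrix.ext fun j k => ?_)) (funext fun j => ?_)
  · fin_cases k
    · exact sub_eq_zero.1 (hcoeff j).1
    · exact sub_eq_zero.1 (hcoeff j).2.1
  · exact sub_eq_zero.1 (hcoeff j).2.2

/-- The number of invertible affine maps sending the parabola to a superset of three given distinct
points is at most the number of ordered triples of distinct parameters. -/
theorem card_affine_parabola_le {p : ℕ} [Fact p.Prime] {v₁ v₂ v₃ : Fin 2 → ZMod p}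
    (h12 : v₁ ≠ v₂) (h13 : v₁ ≠ v₃) (h23 : v₂ ≠ v₃) :
    Nat.card {g : (Matrix (Fin 2) (Fin 2) (ZMod p))ˣ × (Fin 2 → ZMod p) //
        ({v₁, v₂, v₃} : Set (Fin 2 → ZMod p)) ⊆ affImage g (stdParabola p)} ≤
      p.descFactorial 3 := by
  have hv : Function.Injective ![v₁, v₂, v₃] := by
    intro i j hij
    fin_cases i <;> fin_cases j <;> simp_all
  have hex (g : {g : (Matrix (Fin 2) (Fin 2) (ZMod p))ˣ × (Fin 2 → ZMod p) //
      ({v₁, v₂, v₃} : Set (Fin 2 → ZMod p)) ⊆ affImage g (stdParabola p)}) :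
      ∃ t : Fin 3 ↪ ZMod p, ∀ i,
        (g.1.1 : Matrix (Fin 2) (Fin 2) (ZMod p)).mulVec ![t i, t i ^ 2] + g.1.2 =
          ![v₁, v₂, v₃] i := by
    have hmem (i : Fin 3) : ∃ t : ZMod p,
        (g.1.1 : Matrix (Fin 2) (Fin 2) (ZMod p)).mulVec ![t, t ^ 2] + g.1.2 =
          ![v₁, v₂, v₃] i := by
      have hi : ![v₁, v₂, v₃] i ∈ ({v₁, v₂, v₃} : Set (Fin 2 → ZMod p)) := by
        fin_cases i <;> simp
      obtain ⟨_, ⟨t, rfl⟩, ht⟩ := g.2 hi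
      exact ⟨t, ht⟩
    choose t ht using hmem
    refine ⟨⟨t, fun i j hij => hv ?_⟩, ht⟩
    rw [← ht i, ← ht j, hij]
  choose T hT using hex
  have hinj : Function.Injective T := fun g h hgh =>
    Subtype.ext <| affine_eq_of_eqOn_parabola (T g).injective fun i => by
      rw [hT g i, hgh, hT h i]
  calc _ ≤ Nat.card (Fin 3 ↪ ZMod p) := Nat.card_le_card_of_injective T hinj
    _ = p.descFactorial 3 := by
      rw [Nat.card_eq_fintype_card, Fintype.card_embedding_eq, Fintype.card_fin, ZMod.card]

theorem three_points_on_random_parabola (p : ℕ) (hp : p.Prime) (hodd : Odd p)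
    (v₁ v₂ v₃ : Fin 2 → ZMod p)
    (h12 : v₁ ≠ v₂) (h13 : v₁ ≠ v₃) (h23 : v₂ ≠ v₃) :
    p ^ 3 * Nat.card {g : (Matrix (Fin 2) (Fin 2) (ZMod p))ˣ × (Fin 2 → ZMod p) //
        ({v₁, v₂, v₃} : Set (Fin 2 → ZMod p)) ⊆ affImage g (stdParabola p)} ≤
      Nat.card ((Matrix (Fin 2) (Fin 2) (ZMod p))ˣ × (Fin 2 → ZMod p)) := by
  have : Fact p.Prime := ⟨hp⟩
  have hGL : Nat.card (Matrix (Fin 2) (Fin 2) (ZMod p))ˣ = (p ^ 2 - 1) * (p ^ 2 - p) := by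
    have := Matrix.card_GL_field (𝔽 := ZMod p) 2
    simpa [Fin.prod_univ_two, ZMod.card] using this
  have hV : Nat.card (Fin 2 → ZMod p) = p ^ 2 := by simp
  rw [Nat.card_prod, hGL, hV]
  refine (Nat.mul_le_mul_left _ (card_affine_parabola_le h12 h13 h23)).trans ?_
  obtain ⟨n, rfl⟩ := Nat.exists_eq_add_of_le' hp.two_le
  have h1 : (n + 2) ^ 2 - 1 = (n + 1) * (n + 3) := by
    rw [Nat.sub_eq_iff_eq_add (Nat.one_le_pow _ _ (by lia))]; ring
  have h2 : (n + 2) ^ 2 - (n + 2) = (n + 2) * (n + 1) := by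
    rw [Nat.sub_eq_iff_eq_add (by nlinarith)]; ring
  have h3 : (n + 2).descFactorial 3 = n * ((n + 1) * (n + 2)) := by
    simp [Nat.descFactorial_succ]
  rw [h1, h2, h3]
  calc (n + 2) ^ 3 * (n * ((n + 1) * (n + 2)))
      = (n + 2) ^ 3 * (n + 1) * (n * (n + 2)) := by ring
    _ ≤ (n + 2) ^ 3 * (n + 1) * ((n + 1) * (n + 3)) :=
      Nat.mul_le_mul_left _ (Nat.mul_le_mul (by lia) (by lia))
    _ = _ := by ring
end

section
/- Let p be an odd prime and let v₁, v₂, v₃, v₄ ∈ 𝔽_p² be four pairwise distinct vectors. Then p⁴ · #{g : 𝔽_p² → 𝔽_p² invertible affine map with {v₁, v₂, v₃, v₄} ⊆ g(P₀)} ≤ 4 · #{all invertible affine maps g : 𝔽_p² → 𝔽_p²}. Equivalently, if P = g(P₀) for a uniformly random invertible affine map g, then Pr[{v₁, v₂, v₃, v₄} ⊆ P] ≤ 4·p^{−4}. -/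
open Polynomial in
theorem card_quadratic_solutions_le_two {F : Type*} [Field F] [Fintype F] [DecidableEq F]
    (a b c : F) (hb : b ≠ 0) :
    (Finset.univ.filter fun t : F => a * t ^ 2 + b * t + c = 0).card ≤ 2 := by
  set f : F[X] := C a * X ^ 2 + C b * X + C c with hf
  have hf0 : f ≠ 0 := by
    intro h
    have h1 : f.coeff 1 = 0 := by rw [h, coeff_zero]
    simp [hf, coeff_C] at h1
    exact hb h1
  calc (Finset.univ.filter fun t : F => a * t ^ 2 + b * t + c = 0).card
      ≤ f.roots.toFinset.card := by
        refine Finset.card_le_card fun t ht => ?_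
        rw [Multiset.mem_toFinset, mem_roots hf0, IsRoot]
        simpa [hf] using ht
    _ ≤ Multiset.card f.roots := Multiset.toFinset_card_le _
    _ ≤ f.natDegree := card_roots' f
    _ ≤ 2 := natDegree_quadratic_le

theorem exists_param_of_mem_affImage {p : ℕ}
    (g : (Matrix (Fin 2) (Fin 2) (ZMod p))ˣ × (Fin 2 → ZMod p)) (v : Fin 2 → ZMod p)
    (hv : v ∈ affImage g (stdParabola p)) :
    ∃ t : ZMod p, (g.1 : Matrix (Fin 2) (Fin 2) (ZMod p)).mulVec ![t, t ^ 2] + g.2 = v := by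
  obtain ⟨_, ⟨t, rfl⟩, h⟩ := hv
  exact ⟨t, h⟩

/-- An affine map is determined by its values at three points of the standard parabola. -/
theorem affine_eq_of_three_points {F : Type*} [Field F] {M N : Matrix (Fin 2) (Fin 2) F}
    {w z : Fin 2 → F} {t₁ t₂ t₃ : F} (h12 : t₁ ≠ t₂) (h13 : t₁ ≠ t₃) (h23 : t₂ ≠ t₃)
    (h₁ : M.mulVec ![t₁, t₁ ^ 2] + w = N.mulVec ![t₁, t₁ ^ 2] + z)
    (h₂ : M.mulVec ![t₂, t₂ ^ 2] + w = N.mulVec ![t₂, t₂ ^ 2] + z)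
    (h₃ : M.mulVec ![t₃, t₃ ^ 2] + w = N.mulVec ![t₃, t₃ ^ 2] + z) :
    M = N ∧ w = z := by
  have key : ∀ i, M i 0 = N i 0 ∧ M i 1 = N i 1 ∧ w i = z i := by
    intro i
    have e₁ := congrFun h₁ i
    have e₂ := congrFun h₂ i
    have e₃ := congrFun h₃ i
    simp only [Pi.add_apply, Matrix.mulVec, dotProduct, Fin.sum_univ_two,
      Matrix.cons_val_zero, Matrix.cons_val_one] at e₁ e₂ e₃
    have hd : (t₁ - t₂) * (t₁ - t₃) * (t₂ - t₃) ≠ 0 :=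
      mul_ne_zero (mul_ne_zero (sub_ne_zero.2 h12) (sub_ne_zero.2 h13)) (sub_ne_zero.2 h23)
    have k₁ : M i 1 = N i 1 := by
      refine mul_left_cancel₀ hd ?_
      linear_combination (t₂ - t₃) * e₁ - (t₁ - t₃) * e₂ + (t₁ - t₂) * e₃
    have k₀ : M i 0 = N i 0 := by
      refine mul_left_cancel₀ (sub_ne_zero.2 h12) ?_
      linear_combination e₁ - e₂ - (t₁ ^ 2 - t₂ ^ 2) * k₁
    exact ⟨k₀, k₁, by linear_combination e₁ - t₁ * k₀ - t₁ ^ 2 * k₁⟩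
  refine ⟨?_, funext fun i => (key i).2.2⟩
  ext i j
  fin_cases j
  · exact (key i).1
  · exact (key i).2.1

/-- Among four points on the image of the parabola under an affine map, the last is an affine
combination of the first three with nonzero coefficients. -/
theorem exists_affine_relation {F : Type*} [Field F] {M : Matrix (Fin 2) (Fin 2) F}
    {w v₁ v₂ v₃ v₄ : Fin 2 → F} {u₁ u₂ u₃ u₄ : F}
    (h12 : v₁ ≠ v₂) (h13 : v₁ ≠ v₃) (h14 : v₁ ≠ v₄)
    (h23 : v₂ ≠ v₃) (h24 : v₂ ≠ v₄) (h34 : v₃ ≠ v₄)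
    (h₁ : M.mulVec ![u₁, u₁ ^ 2] + w = v₁) (h₂ : M.mulVec ![u₂, u₂ ^ 2] + w = v₂)
    (h₃ : M.mulVec ![u₃, u₃ ^ 2] + w = v₃) (h₄ : M.mulVec ![u₄, u₄ ^ 2] + w = v₄) :
    ∃ β γ : F, β ≠ 0 ∧ γ ≠ 0 ∧ ∀ i, v₄ i - v₁ i = β * (v₂ i - v₁ i) + γ * (v₃ i - v₁ i) := by
  have d12 : u₂ - u₁ ≠ 0 := fun h => h12 (by rw [← h₁, ← h₂, sub_eq_zero.1 h])
  have d13 : u₃ - u₁ ≠ 0 := fun h => h13 (by rw [← h₁, ← h₃, sub_eq_zero.1 h])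
  have d14 : u₄ - u₁ ≠ 0 := fun h => h14 (by rw [← h₁, ← h₄, sub_eq_zero.1 h])
  have d23 : u₃ - u₂ ≠ 0 := fun h => h23 (by rw [← h₂, ← h₃, sub_eq_zero.1 h])
  have d24 : u₄ - u₂ ≠ 0 := fun h => h24 (by rw [← h₂, ← h₄, sub_eq_zero.1 h])
  have d34 : u₄ - u₃ ≠ 0 := fun h => h34 (by rw [← h₃, ← h₄, sub_eq_zero.1 h])
  refine ⟨-((u₄ - u₁) * (u₄ - u₃)) / ((u₂ - u₁) * (u₃ - u₂)),
    (u₄ - u₁) * (u₄ - u₂) / ((u₃ - u₁) * (u₃ - u₂)),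
    div_ne_zero (neg_ne_zero.2 (mul_ne_zero d14 d34)) (mul_ne_zero d12 d23),
    div_ne_zero (mul_ne_zero d14 d24) (mul_ne_zero d13 d23), fun i => ?_⟩
  subst h₁ h₂ h₃ h₄
  simp only [Pi.add_apply, Matrix.mulVec, dotProduct, Fin.sum_univ_two,
    Matrix.cons_val_zero, Matrix.cons_val_one]
  field_simp
  ring

/-- An affine relation between the images of points of the parabola under an invertible affine map
yields a quadratic equation for their parameters. -/
theorem params_quadratic_of_affine_relation {F : Type*} [Field F]
    {M : (Matrix (Fin 2) (Fin 2) F)ˣ} {w v₁ v₂ v₃ v₄ : Fin 2 → F} {t₁ t₂ t₃ t₄ β γ : F}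
    (hv : ∀ i, v₄ i - v₁ i = β * (v₂ i - v₁ i) + γ * (v₃ i - v₁ i))
    (h₁ : (M : Matrix (Fin 2) (Fin 2) F).mulVec ![t₁, t₁ ^ 2] + w = v₁)
    (h₂ : (M : Matrix (Fin 2) (Fin 2) F).mulVec ![t₂, t₂ ^ 2] + w = v₂)
    (h₃ : (M : Matrix (Fin 2) (Fin 2) F).mulVec ![t₃, t₃ ^ 2] + w = v₃)
    (h₄ : (M : Matrix (Fin 2) (Fin 2) F).mulVec ![t₄, t₄ ^ 2] + w = v₄) :
    γ * (1 - γ) * (t₃ - t₁) ^ 2 - 2 * β * γ * (t₂ - t₁) * (t₃ - t₁)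
      + β * (1 - β) * (t₂ - t₁) ^ 2 = 0 := by
  have h : (M : Matrix (Fin 2) (Fin 2) F).mulVec
      ![t₄ - t₁ - β * (t₂ - t₁) - γ * (t₃ - t₁),
        t₄ ^ 2 - t₁ ^ 2 - β * (t₂ ^ 2 - t₁ ^ 2) - γ * (t₃ ^ 2 - t₁ ^ 2)] = 0 := by
    ext i
    have e := hv i
    subst h₁ h₂ h₃ h₄
    simp only [Pi.add_apply, Pi.zero_apply, Matrix.mulVec, dotProduct, Fin.sum_univ_two,
      Matrix.cons_val_zero, Matrix.cons_val_one] at e ⊢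
    linear_combination e
  have h0 := Matrix.mulVec_injective_of_isUnit M.isUnit (h.trans (Matrix.mulVec_zero _).symm)
  have e₀ := congrFun h0 0
  have e₁ := congrFun h0 1
  simp only [Pi.zero_apply, Matrix.cons_val_zero, Matrix.cons_val_one] at e₀ e₁
  linear_combination (t₄ + t₁ + β * (t₂ - t₁) + γ * (t₃ - t₁)) * e₀ - e₁

theorem card_affine_maps (p : ℕ) [Fact p.Prime] :
    Nat.card ((Matrix (Fin 2) (Fin 2) (ZMod p))ˣ × (Fin 2 → ZMod p))
      = (p ^ 2 - 1) * (p ^ 2 - p) * p ^ 2 := by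
  have h : Nat.card (Matrix (Fin 2) (Fin 2) (ZMod p))ˣ = (p ^ 2 - 1) * (p ^ 2 - p) := by
    simpa [Fin.prod_univ_two, ZMod.card] using Matrix.card_GL_field (𝔽 := ZMod p) 2
  rw [Nat.card_prod, h]
  simp

/-- At most `2 (p² - p)` invertible affine maps send the parabola to one through four given
points. -/
theorem card_affine_maps_through_four_points_le (p : ℕ) [Fact p.Prime] (hodd : Odd p)
    (v₁ v₂ v₃ v₄ : Fin 2 → ZMod p)
    (h12 : v₁ ≠ v₂) (h13 : v₁ ≠ v₃) (h14 : v₁ ≠ v₄)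
    (h23 : v₂ ≠ v₃) (h24 : v₂ ≠ v₄) (h34 : v₃ ≠ v₄) :
    Nat.card {g : (Matrix (Fin 2) (Fin 2) (ZMod p))ˣ × (Fin 2 → ZMod p) //
        ({v₁, v₂, v₃, v₄} : Set (Fin 2 → ZMod p)) ⊆ affImage g (stdParabola p)}
      ≤ (p ^ 2 - p) * 2 := by
  set S := {g : (Matrix (Fin 2) (Fin 2) (ZMod p))ˣ × (Fin 2 → ZMod p) //
        ({v₁, v₂, v₃, v₄} : Set (Fin 2 → ZMod p)) ⊆ affImage g (stdParabola p)}
  choose t₁ ht₁ using fun g : S => exists_param_of_mem_affImage g.1 v₁ (g.2 (by simp))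
  choose t₂ ht₂ using fun g : S => exists_param_of_mem_affImage g.1 v₂ (g.2 (by simp))
  choose t₃ ht₃ using fun g : S => exists_param_of_mem_affImage g.1 v₃ (g.2 (by simp))
  choose t₄ ht₄ using fun g : S => exists_param_of_mem_affImage g.1 v₄ (g.2 (by simp))
  rcases isEmpty_or_nonempty S with hE | ⟨⟨g₀⟩⟩
  · simp
  obtain ⟨β, γ, hβ, hγ, hv⟩ := exists_affine_relation h12 h13 h14 h23 h24 h34
    (ht₁ g₀) (ht₂ g₀) (ht₃ g₀) (ht₄ g₀)
  have n12 : ∀ g, t₁ g ≠ t₂ g := fun g h => h12 <|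
    (ht₁ g).symm.trans (by rw [h]; exact ht₂ g)
  have n13 : ∀ g, t₁ g ≠ t₃ g := fun g h => h13 <|
    (ht₁ g).symm.trans (by rw [h]; exact ht₃ g)
  have n23 : ∀ g, t₂ g ≠ t₃ g := fun g h => h23 <|
    (ht₂ g).symm.trans (by rw [h]; exact ht₃ g)
  have two_ne : (2 : ZMod p) ≠ 0 :=
    Ring.two_ne_zero (by rw [ZMod.ringChar_zmod_n]; rintro rfl; exact absurd hodd (by decide))
  let T : Finset (Σ _ : ZMod p × ZMod p, ZMod p) :=
    (Finset.univ : Finset (ZMod p)).offDiag.sigma fun x => Finset.univ.filter fun r =>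
      γ * (1 - γ) * r ^ 2 + -(2 * β * γ * (x.2 - x.1)) * r + β * (1 - β) * (x.2 - x.1) ^ 2 = 0
  have hT : T.card ≤ (p ^ 2 - p) * 2 := by
    rw [Finset.card_sigma]
    refine (Finset.sum_le_card_nsmul _ _ 2 fun x hx => ?_).trans_eq ?_
    · refine card_quadratic_solutions_le_two _ _ _ (neg_ne_zero.2 ?_)
      exact mul_ne_zero (mul_ne_zero (mul_ne_zero two_ne hβ) hγ)
        (sub_ne_zero.2 (Finset.mem_offDiag.1 hx).2.2.symm)
    · rw [Finset.offDiag_card, Finset.card_univ, ZMod.card, smul_eq_mul, sq]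
  let φ : S → T := fun g => ⟨⟨(t₁ g, t₂ g), t₃ g - t₁ g⟩, by
    refine Finset.mem_sigma.2 ⟨by simpa using n12 g, ?_⟩
    simp only [Finset.mem_filter, Finset.mem_univ, true_and]
    linear_combination
      params_quadratic_of_affine_relation hv (ht₁ g) (ht₂ g) (ht₃ g) (ht₄ g)⟩
  have hφ : Function.Injective φ := by
    intro g g' h
    simp only [φ, Subtype.mk.injEq, Sigma.mk.injEq, Prod.mk.injEq, heq_eq_eq] at h
    obtain ⟨⟨e₁, e₂⟩, e₃⟩ := h
    rw [e₁, sub_left_inj] at e₃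
    have a₁ := (ht₁ g).trans (ht₁ g').symm
    have a₂ := (ht₂ g).trans (ht₂ g').symm
    have a₃ := (ht₃ g).trans (ht₃ g').symm
    rw [← e₁] at a₁
    rw [← e₂] at a₂
    rw [← e₃] at a₃
    obtain ⟨hM, hw⟩ := affine_eq_of_three_points (n12 g) (n13 g) (n23 g) a₁ a₂ a₃
    exact Subtype.ext (Prod.ext (Units.ext hM) hw)
  calc Nat.card S ≤ Nat.card T := Nat.card_le_card_of_injective φ hφ
    _ = T.card := by simp
    _ ≤ (p ^ 2 - p) * 2 := hT


theorem four_points_on_random_parabola (p : ℕ) (hp : p.Prime) (hodd : Odd p)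
    (v₁ v₂ v₃ v₄ : Fin 2 → ZMod p)
    (h12 : v₁ ≠ v₂) (h13 : v₁ ≠ v₃) (h14 : v₁ ≠ v₄)
    (h23 : v₂ ≠ v₃) (h24 : v₂ ≠ v₄) (h34 : v₃ ≠ v₄) :
    p ^ 4 * Nat.card {g : (Matrix (Fin 2) (Fin 2) (ZMod p))ˣ × (Fin 2 → ZMod p) //
        ({v₁, v₂, v₃, v₄} : Set (Fin 2 → ZMod p)) ⊆ affImage g (stdParabola p)} ≤
      4 * Nat.card ((Matrix (Fin 2) (Fin 2) (ZMod p))ˣ × (Fin 2 → ZMod p)) := by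
  have : Fact p.Prime := ⟨hp⟩
  rw [card_affine_maps]
  have hp2 : p ^ 2 ≤ 2 * (p ^ 2 - 1) := by
    have := Nat.pow_le_pow_left hp.two_le 2
    omega
  calc _ ≤ p ^ 4 * ((p ^ 2 - p) * 2) := Nat.mul_le_mul_left _
        (card_affine_maps_through_four_points_le p hodd v₁ v₂ v₃ v₄ h12 h13 h14 h23 h24 h34)
    _ = p ^ 2 * (2 * (p ^ 2 - p) * p ^ 2) := by ring
    _ ≤ 2 * (p ^ 2 - 1) * (2 * (p ^ 2 - p) * p ^ 2) := Nat.mul_le_mul_right _ hp2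
    _ = 4 * ((p ^ 2 - 1) * (p ^ 2 - p) * p ^ 2) := by ring
end

section
/- Let p be an odd prime and let v₁, v₂, v₃ ∈ 𝔽_p² be three points that are not collinear (i.e., affinely independent). Then the number of invertible affine maps g : 𝔽_p² → 𝔽_p² such that {v₁, v₂, v₃} ⊆ g(P₀) is exactly p(p−1)(p−2). -/
/-- The matrix whose rows are the edge vectors `u 1 - u 0` and `u 2 - u 0` of a plane triangle. -/
def edgeMatrix {K : Type*} [Field K] (u : Fin 3 → Fin 2 → K) : Matrix (Fin 2) (Fin 2) K :=
  Matrix.of fun i => u i.succ - u 0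

theorem isUnit_edgeMatrix_iff {K : Type*} [Field K] (u : Fin 3 → Fin 2 → K) :
    IsUnit (edgeMatrix u) ↔ AffineIndependent K u := by
  rw [affineIndependent_iff_linearIndependent_vsub K u 0,
    ← linearIndependent_equiv (finSuccAboveEquiv (0 : Fin 3)),
    ← Matrix.linearIndependent_rows_iff_isUnit]
  rfl

theorem edgeMatrix_affine_image {K : Type*} [Field K] {u v : Fin 3 → Fin 2 → K}
    {M : Matrix (Fin 2) (Fin 2) K} {w : Fin 2 → K} (h : ∀ i, M.mulVec (u i) + w = v i) :
    edgeMatrix v = edgeMatrix u * M.transpose := by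
  ext i j
  simp only [edgeMatrix, ← h, Matrix.of_apply, Matrix.mul_apply, Matrix.transpose_apply,
    Pi.add_apply, Pi.sub_apply, Matrix.mulVec, dotProduct, Fin.sum_univ_two]
  ring

/-- An invertible affine map of the plane is determined by the images of three affinely
independent points, which may be prescribed to be any three affinely independent points. -/
theorem existsUnique_affine_map {K : Type*} [Field K] {u v : Fin 3 → Fin 2 → K}
    (hu : AffineIndependent K u) (hv : AffineIndependent K v) :
    ∃! g : (Matrix (Fin 2) (Fin 2) K)ˣ × (Fin 2 → K),
      ∀ i, (g.1 : Matrix (Fin 2) (Fin 2) K).mulVec (u i) + g.2 = v i := by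
  obtain ⟨U, hU⟩ := (isUnit_edgeMatrix_iff u).2 hu
  obtain ⟨V, hV⟩ := (isUnit_edgeMatrix_iff v).2 hv
  obtain ⟨M, hM⟩ := (Matrix.isUnit_transpose _).2 (U⁻¹ * V).isUnit
  have key : edgeMatrix u * (M : Matrix (Fin 2) (Fin 2) K).transpose = edgeMatrix v := by
    rw [hM, Matrix.transpose_transpose, ← hU, ← hV, ← Units.val_mul, mul_inv_cancel_left]
  refine ⟨(M, v 0 - (M : Matrix (Fin 2) (Fin 2) K).mulVec (u 0)), ?_, ?_⟩
  · intro i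
    refine Fin.cases (add_sub_cancel _ _) (fun i => ?_) i
    ext j
    have := congrFun (congrFun key i) j
    simp only [edgeMatrix, Matrix.of_apply, Matrix.mul_apply, Matrix.transpose_apply,
      Pi.sub_apply, Fin.sum_univ_two] at this
    simp only [Pi.add_apply, Pi.sub_apply, Matrix.mulVec, dotProduct, Fin.sum_univ_two]
    linear_combination this
  · rintro ⟨N, w⟩ hN
    have hNM : N = M := by
      apply Units.ext
      apply Matrix.transpose_injective
      apply U.isUnit.mul_left_cancel
      rw [hU, key, edgeMatrix_affine_image hN]
    subst hNM
    exact Prod.ext rfl (eq_sub_of_add_eq' (hN 0))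

theorem affineIndependent_parabola {K : Type*} [Field K] (t : Fin 3 ↪ K) :
    AffineIndependent K fun i => ![t i, t i ^ 2] := by
  rw [← isUnit_edgeMatrix_iff, Matrix.isUnit_iff_isUnit_det, isUnit_iff_ne_zero,
    Matrix.det_fin_two]
  have h (i j : Fin 3) (hij : i ≠ j) : t i - t j ≠ 0 := sub_ne_zero.2 (t.injective.ne hij)
  convert mul_ne_zero (mul_ne_zero (h 1 0 (by decide)) (h 2 0 (by decide))) (h 2 1 (by decide))
    using 1
  simp [edgeMatrix]
  ring

theorem triple_subset_affImage_iff {p : ℕ}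
    (g : (Matrix (Fin 2) (Fin 2) (ZMod p))ˣ × (Fin 2 → ZMod p)) (v₁ v₂ v₃ : Fin 2 → ZMod p) :
    ({v₁, v₂, v₃} : Set (Fin 2 → ZMod p)) ⊆ affImage g (stdParabola p) ↔
      ∃ t : Fin 3 → ZMod p, ∀ i, (g.1 : Matrix (Fin 2) (Fin 2) (ZMod p)).mulVec
        ![t i, t i ^ 2] + g.2 = ![v₁, v₂, v₃] i := by
  have hmem (v : Fin 2 → ZMod p) : v ∈ affImage g (stdParabola p) ↔
      ∃ t : ZMod p, (g.1 : Matrix (Fin 2) (Fin 2) (ZMod p)).mulVec ![t, t ^ 2] + g.2 = v := by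
    simp [affImage, stdParabola]
  rw [← Classical.skolem (p := fun (i : Fin 3) (t : ZMod p) =>
    (g.1 : Matrix (Fin 2) (Fin 2) (ZMod p)).mulVec ![t, t ^ 2] + g.2 = ![v₁, v₂, v₃] i)]
  simp only [Set.insert_subset_iff, Set.singleton_subset_iff, hmem, Fin.forall_fin_succ]
  simp

theorem count_affine_maps_parabola_through_noncollinear_triple
    (p : ℕ) (hp : p.Prime) (hodd : Odd p)
    (v₁ v₂ v₃ : Fin 2 → ZMod p)
    (h : AffineIndependent (ZMod p) ![v₁, v₂, v₃]) :
    Nat.card {g : (Matrix (Fin 2) (Fin 2) (ZMod p))ˣ × (Fin 2 → ZMod p) //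
        ({v₁, v₂, v₃} : Set (Fin 2 → ZMod p)) ⊆ affImage g (stdParabola p)} =
      p * (p - 1) * (p - 2) := by
  have : Fact p.Prime := ⟨hp⟩
  choose F hF hFu using fun t : Fin 3 ↪ ZMod p =>
    existsUnique_affine_map (affineIndependent_parabola t) h
  have hbij : Function.Bijective fun t : Fin 3 ↪ ZMod p =>
      (⟨F t, (triple_subset_affImage_iff _ _ _ _).2 ⟨t, hF t⟩⟩ :
        {g : (Matrix (Fin 2) (Fin 2) (ZMod p))ˣ × (Fin 2 → ZMod p) //
          ({v₁, v₂, v₃} : Set (Fin 2 → ZMod p)) ⊆ affImage g (stdParabola p)}) := by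
    constructor
    · intro s t hst
      have hst : F s = F t := congrArg Subtype.val hst
      ext i
      have hi := (hF s i).trans (hF t i).symm
      rw [hst] at hi
      exact congrFun (Matrix.mulVec_injective_of_isUnit (F t).1.isUnit (add_right_cancel hi)) 0
    · rintro ⟨g, hg⟩
      obtain ⟨t, ht⟩ := (triple_subset_affImage_iff _ _ _ _).1 hg
      have htinj : Function.Injective t := fun i j hij =>
        h.injective (by rw [← ht i, ← ht j, hij])
      exact ⟨⟨t, htinj⟩, Subtype.ext (hFu ⟨t, htinj⟩ g ht).symm⟩
  rw [← Nat.card_eq_of_bijective _ hbij, Nat.card_eq_fintype_card, Fintype.card_embedding_eq,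
    ZMod.card, Fintype.card_fin]
  simp [Nat.descFactorial_succ]
  ring
end

section
/- Let p be an odd prime. Then the number of distinct sets of the form g(P₀), where g : 𝔽_p² → 𝔽_p² ranges over invertible affine maps, that contain all three points (0,0), (1,0), (0,1), is exactly p − 2. -/
/-- The parabola `(x + l y)² = x + l² y`. -/
def normalizedParabola {p : ℕ} (l : ZMod p) : Set (Fin 2 → ZMod p) :=
  {v | (v 0 + l * v 1) ^ 2 = v 0 + l ^ 2 * v 1}

theorem mem_stdParabola_iff {p : ℕ} (v : Fin 2 → ZMod p) :
    v ∈ stdParabola p ↔ v 0 ^ 2 = v 1 := by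
  constructor
  · rintro ⟨t, rfl⟩
    simp
  · intro h
    refine ⟨v 0, ?_⟩
    ext i
    fin_cases i <;> simp [h]

theorem mem_affImage_iff {p : ℕ}
    (g : (Matrix (Fin 2) (Fin 2) (ZMod p))ˣ × (Fin 2 → ZMod p))
    (S : Set (Fin 2 → ZMod p)) (v : Fin 2 → ZMod p) :
    v ∈ affImage g S ↔
      ((g.1⁻¹ : (Matrix (Fin 2) (Fin 2) (ZMod p))ˣ) : Matrix (Fin 2) (Fin 2) (ZMod p)).mulVec
        (v - g.2) ∈ S := by
  constructor
  · rintro ⟨x, hx, rfl⟩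
    rwa [add_sub_cancel_right, Matrix.mulVec_mulVec, Units.inv_mul, Matrix.one_mulVec]
  · intro h
    refine ⟨_, h, ?_⟩
    dsimp only
    rw [Matrix.mulVec_mulVec, Units.mul_inv, Matrix.one_mulVec, sub_add_cancel]

theorem exists_affImage_eq_normalizedParabola {p : ℕ} [Fact p.Prime] {l : ZMod p}
    (h0 : l ≠ 0) (h1 : l ≠ 1) :
    ∃ g : (Matrix (Fin 2) (Fin 2) (ZMod p))ˣ × (Fin 2 → ZMod p),
      normalizedParabola l = affImage g (stdParabola p) := by
  have hdet : IsUnit (!![1, l; 1, l ^ 2] : Matrix (Fin 2) (Fin 2) (ZMod p)) := by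
    rw [Matrix.isUnit_iff_isUnit_det, Matrix.det_fin_two_of, isUnit_iff_ne_zero]
    have : 1 * l ^ 2 - l * 1 = l * (l - 1) := by ring
    rw [this]
    exact mul_ne_zero h0 (sub_ne_zero.mpr h1)
  obtain ⟨N, hN⟩ := hdet
  refine ⟨(N⁻¹, 0), ?_⟩
  ext v
  rw [mem_affImage_iff, mem_stdParabola_iff]
  simp [hN, normalizedParabola, Matrix.mulVec, dotProduct, Fin.sum_univ_two]

theorem exists_normalizedParabola_eq_affImage {p : ℕ} [Fact p.Prime]
    (g : (Matrix (Fin 2) (Fin 2) (ZMod p))ˣ × (Fin 2 → ZMod p))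
    (h00 : ![0, 0] ∈ affImage g (stdParabola p))
    (h10 : ![1, 0] ∈ affImage g (stdParabola p))
    (h01 : ![0, 1] ∈ affImage g (stdParabola p)) :
    ∃ l : ZMod p, l ≠ 0 ∧ l ≠ 1 ∧ normalizedParabola l = affImage g (stdParabola p) := by
  have hdet : IsUnit ((g.1⁻¹ : (Matrix (Fin 2) (Fin 2) (ZMod p))ˣ) :
      Matrix (Fin 2) (Fin 2) (ZMod p)) := Units.isUnit _
  rw [Matrix.isUnit_iff_isUnit_det, isUnit_iff_ne_zero, Matrix.det_fin_two] at hdet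
  have key := fun v => (mem_affImage_iff g (stdParabola p) v).trans (mem_stdParabola_iff _)
  rw [key] at h00 h10 h01
  generalize ((g.1⁻¹ : (Matrix (Fin 2) (Fin 2) (ZMod p))ˣ) :
      Matrix (Fin 2) (Fin 2) (ZMod p)) = N at *
  simp only [Matrix.mulVec, dotProduct, Fin.sum_univ_two, Pi.sub_apply, Matrix.cons_val_zero,
    Matrix.cons_val_one] at key h00 h10 h01
  generalize N 0 0 = a, N 0 1 = b, N 1 0 = c, N 1 1 = d, g.2 0 = r, g.2 1 = s at *
  have hc : c = a ^ 2 - 2 * a * (a * r + b * s) := by linear_combination h00 - h10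
  have hd : d = b ^ 2 - 2 * b * (a * r + b * s) := by linear_combination h00 - h01
  have hprod : a * b * (b - a) ≠ 0 := by
    intro h
    apply hdet
    rw [hc, hd]
    linear_combination h
  have ha : a ≠ 0 := by rintro rfl; simp at hprod
  have hb : b ≠ 0 := by rintro rfl; simp at hprod
  have hba : b - a ≠ 0 := by intro h; simp [h] at hprod
  refine ⟨b / a, div_ne_zero hb ha, ?_, ?_⟩
  · rw [Ne, div_eq_one_iff_eq ha]
    exact fun h => hba (sub_eq_zero.mpr h)
  · ext v
    rw [key]
    simp only [normalizedParabola, Set.mem_ofPred_eq]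
    rw [← sub_eq_zero, ← mul_eq_zero_iff_left (pow_ne_zero 2 ha), ← sub_eq_zero (b := c * _ + _)]
    have e : a ^ 2 * ((v 0 + b / a * v 1) ^ 2 - (v 0 + (b / a) ^ 2 * v 1)) =
        (a * v 0 + b * v 1) ^ 2 - (a ^ 2 * v 0 + b ^ 2 * v 1) := by
      field_simp
    rw [e, hc, hd]
    rw [hc, hd] at h00
    constructor <;> intro h
    · linear_combination h + h00
    · linear_combination h - h00

theorem normalizedParabola_injOn {p : ℕ} [Fact p.Prime] (hodd : Odd p) :
    Set.InjOn (normalizedParabola (p := p)) {l | l ≠ 0 ∧ l ≠ 1} := by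
  rintro l ⟨hl0, hl1⟩ m ⟨hm0, hm1⟩ h
  by_cases hp3 : p = 3
  · subst hp3
    clear h hodd
    decide +revert
  have hprime := (Fact.out : p.Prime)
  have h2 : (2 : ZMod p) ≠ 0 := by
    intro h
    have := (Nat.prime_dvd_prime_iff_eq hprime Nat.prime_two).mp
      ((ZMod.natCast_eq_zero_iff 2 p).mp (by exact_mod_cast h))
    subst this
    exact absurd hodd (by decide)
  have h3 : (3 : ZMod p) ≠ 0 := fun h => hp3 <|
    (Nat.prime_dvd_prime_iff_eq hprime Nat.prime_three).mp
      ((ZMod.natCast_eq_zero_iff 3 p).mp (by exact_mod_cast h))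
  have hD : l * (l - 1) ≠ 0 := mul_ne_zero hl0 (sub_ne_zero.mpr hl1)
  obtain ⟨y, hy⟩ : ∃ y, y * (l * (l - 1)) = 2 := ⟨2 / (l * (l - 1)), div_mul_cancel₀ _ hD⟩
  have hy0 : y ≠ 0 := by rintro rfl; exact h2 (by rw [← hy, zero_mul])
  have hA : ![2 - l * y, y] ∈ normalizedParabola l := by
    simp only [normalizedParabola, Set.mem_ofPred_eq, Matrix.cons_val_zero, Matrix.cons_val_one]
    linear_combination -hy
  have hB : ![-1 - l * y, y] ∈ normalizedParabola l := by
    simp only [normalizedParabola, Set.mem_ofPred_eq, Matrix.cons_val_zero, Matrix.cons_val_one]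
    linear_combination -hy
  rw [h] at hA hB
  simp only [normalizedParabola, Set.mem_ofPred_eq, Matrix.cons_val_zero, Matrix.cons_val_one]
    at hA hB
  have : 2 * 3 * y * (m - l) = 0 := by linear_combination hA - hB
  have := (mul_eq_zero.mp this).resolve_left (mul_ne_zero (mul_ne_zero h2 h3) hy0)
  exact (sub_eq_zero.mp this).symm

theorem count_parabolas_through_three_standard_points (p : ℕ) (hp : p.Prime) (hodd : Odd p) :
    Nat.card {S : Set (Fin 2 → ZMod p) //
        (∃ g : (Matrix (Fin 2) (Fin 2) (ZMod p))ˣ × (Fin 2 → ZMod p),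
          S = affImage g (stdParabola p)) ∧
        ({![0, 0], ![1, 0], ![0, 1]} : Set (Fin 2 → ZMod p)) ⊆ S} = p - 2 := by
  have : Fact p.Prime := ⟨hp⟩
  have himage : {S : Set (Fin 2 → ZMod p) |
        (∃ g : (Matrix (Fin 2) (Fin 2) (ZMod p))ˣ × (Fin 2 → ZMod p),
          S = affImage g (stdParabola p)) ∧
        ({![0, 0], ![1, 0], ![0, 1]} : Set (Fin 2 → ZMod p)) ⊆ S} =
      normalizedParabola '' {l | l ≠ 0 ∧ l ≠ 1} := by
    ext S
    constructor
    · rintro ⟨⟨g, rfl⟩, hS⟩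
      obtain ⟨l, h0, h1, h⟩ := exists_normalizedParabola_eq_affImage g (hS (by simp))
        (hS (by simp)) (hS (by simp))
      exact ⟨l, ⟨h0, h1⟩, h⟩
    · rintro ⟨l, ⟨h0, h1⟩, rfl⟩
      refine ⟨exists_affImage_eq_normalizedParabola h0 h1, ?_⟩
      rintro v (rfl | rfl | rfl) <;> simp [normalizedParabola]
  have hcompl : {l : ZMod p | l ≠ 0 ∧ l ≠ 1} = ({0, 1} : Set (ZMod p))ᶜ := by
    ext l
    simp
  have hcard := (normalizedParabola_injOn hodd).ncard_image
  rw [← himage, hcompl, Set.ncard_compl, Set.ncard_pair zero_ne_one, Nat.card_zmod] at hcard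
  exact hcard
end
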